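/- arXiv:2205.07932 — 2 statements merged into one kernel-verified Lean document; each statement's English description precedes it below -/
import Mathlib

section
/- Let V be an n×(p·d) random real matrix uniformly distributed on the Stiefel manifold V(n, p·d), with columns partitioned into p consecutive blocks of d columns. Let B ⊆ {1,…,p} with |B| = b, and let K ⊆ {1,…,p} \ B be a set of q block indices. Suppose (p − b − 1)·d ≥ n. Then for any t₁₄, t₁₅, t₁₆ > 0 with √((b+1)d/n) + t₁₄ < 1, √((b+1)/p) + t₁₅ < 1, √((b+1)/p) + t₁₆ < 1/3, one has P[ max_{k∈K} ‖(p d/n)·V_Bᵀ V_k‖ ≥ (3(√((b+1)d/n) + t₁₄) + 3(√((b+1)/p) + t₁₅)) / (1 − 3(√((b+1)/p) + t₁₆)) ] ≤ q·(2·exp(−n t₁₄²/2) + 2·exp(−p d t₁₅²/2) + exp(−p d t₁₆²/2)). -/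
open MeasureTheory ProbabilityTheory Filter Matrix
open scoped ENNReal NNReal

noncomputable section

/-- Euclidean norm of a finite real vector. -/
def euclNorm {ι : Type*} [Fintype ι] (v : ι → ℝ) : ℝ := Real.sqrt (∑ i, v i ^ 2)

/-- Spectral norm (largest singular value) of a real matrix. -/
def specNorm {m n : Type*} [Fintype m] [Fintype n] [DecidableEq n] (A : Matrix m n ℝ) : ℝ :=
  ‖LinearMap.toContinuousLinearMap (Matrix.toEuclideanLin A)‖

instance {m n α : Type*} [MeasurableSpace α] : MeasurableSpace (Matrix m n α) :=
  inferInstanceAs (MeasurableSpace (m → n → α))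

/-- `V` is uniformly distributed on the Stiefel manifold `V(n, ι)`:
`V Vᵀ = I_n` almost surely and `V·O` has the same distribution as `V` for every
fixed orthogonal matrix `O`. -/
def IsUniformStiefel {Ω ι : Type*} [MeasurableSpace Ω] [Fintype ι] [DecidableEq ι]
    (P : Measure Ω) {n : ℕ} (V : Ω → Matrix (Fin n) ι ℝ) : Prop :=
  Measurable V ∧ (∀ᵐ ω ∂P, V ω * (V ω)ᵀ = 1) ∧
    ∀ O : Matrix ι ι ℝ, O * Oᵀ = 1 →
      Measure.map (fun ω => V ω * O) P = Measure.map V P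

/-- The submatrix of a block matrix `V` consisting of the column blocks indexed by `J`. -/
def blockCols {n p d : ℕ} (V : Matrix (Fin n) (Fin p × Fin d) ℝ) (J : Finset (Fin p)) :
    Matrix (Fin n) ({j // j ∈ J} × Fin d) ℝ :=
  fun i jk => V i (jk.1.1, jk.2)

/-- The `k`-th column block of a block matrix `V`. -/
def colBlock {n p d : ℕ} (V : Matrix (Fin n) (Fin p × Fin d) ℝ) (k : Fin p) :
    Matrix (Fin n) (Fin d) ℝ :=
  fun i l => V i (k, l)

/-- Standard Gaussian product measure. -/
def gpi (ι : Type*) [Fintype ι] : Measure (ι → ℝ) := Measure.pi (fun _ => gaussianReal 0 1)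

instance (ι : Type*) [Fintype ι] : IsProbabilityMeasure (gpi ι) := by
  unfold gpi; infer_instance

/-- Rising product `a (a+2) ... (a+2(k-1))`. -/
def rprod (a : ℝ) (k : ℕ) : ℝ := ∏ j ∈ Finset.range k, (a + 2 * j)

lemma mgf_sq_gauss (t : ℝ) (ht : t < 1 / 2) :
    mgf (fun x : ℝ => x ^ 2) (gaussianReal 0 1) t = (1 - 2 * t) ^ (-(1 / 2) : ℝ) := by
  unfold mgf
  rw [integral_gaussianReal_eq_integral_smul (by norm_num)]
  have h : ∀ x : ℝ, gaussianPDFReal 0 1 x • Real.exp (t * x ^ 2)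
      = (Real.sqrt (2 * Real.pi))⁻¹ * Real.exp (-(1 / 2 - t) * x ^ 2) := by
    intro x
    simp only [gaussianPDFReal, smul_eq_mul, NNReal.coe_one, mul_one, sub_zero]
    rw [mul_assoc, ← Real.exp_add]
    congr 2; ring
  simp_rw [h]
  rw [integral_const_mul, integral_gaussian]
  have h1 : 0 < 1 - 2 * t := by linarith
  rw [Real.rpow_neg h1.le, ← Real.sqrt_eq_rpow, ← Real.sqrt_inv, ← Real.sqrt_inv, ← Real.sqrt_mul (by positivity)]
  congr 1
  have : (1 / 2 - t) ≠ 0 := by linarith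
  field_simp

lemma mgf_sumsq (ι : Type*) [Fintype ι] (t : ℝ) (ht : t < 1 / 2) :
    mgf (fun x : ι → ℝ => ∑ i, x i ^ 2) (gpi ι) t
      = (1 - 2 * t) ^ (-(Fintype.card ι / 2) : ℝ) := by
  have hind : iIndepFun (fun (i : ι) (x : ι → ℝ) => (x i) ^ 2) (gpi ι) :=
    iIndepFun_pi (X := fun _ (x : ℝ) => x ^ 2) (fun i => by fun_prop)
  have h := hind.mgf_sum (t := t) (fun i => by fun_prop) Finset.univ
  have he : (∑ i, fun x : ι → ℝ => (x i) ^ 2) = fun x : ι → ℝ => ∑ i, x i ^ 2 := by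
    ext x; simp
  rw [he] at h
  rw [h]
  have h1 : ∀ i : ι, mgf (fun x : ι → ℝ => x i ^ 2) (gpi ι) t = (1 - 2 * t) ^ (-(1 / 2) : ℝ) := by
    intro i
    rw [← mgf_sq_gauss t ht]
    unfold mgf
    have hp : MeasurePreserving (Function.eval i) (gpi ι) (gaussianReal 0 1) :=
      measurePreserving_eval _ i
    rw [← hp.map_eq, integral_map hp.measurable.aemeasurable (by fun_prop)]
  rw [Finset.prod_congr rfl (fun i _ => h1 i), Finset.prod_const, Finset.card_univ,
    ← Real.rpow_natCast, ← Real.rpow_mul (by linarith)]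
  congr 1; ring

lemma iterDeriv_aux (a : ℝ) (k : ℕ) : ∀ t : ℝ, t < 1 / 2 →
    iteratedDeriv k (fun t : ℝ => (1 - 2 * t) ^ (-(a / 2))) t
      = rprod a k * (1 - 2 * t) ^ (-(a / 2) - k) := by
  induction k with
  | zero => intro t ht; simp [rprod]
  | succ k ih =>
    intro t ht
    rw [iteratedDeriv_succ]
    have hev : iteratedDeriv k (fun t : ℝ => (1 - 2 * t) ^ (-(a / 2)))
        =ᶠ[nhds t] fun t => rprod a k * (1 - 2 * t) ^ (-(a / 2) - k) := by
      filter_upwards [Iio_mem_nhds ht] with s hs using ih s hs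
    rw [hev.deriv_eq]
    have hd : HasDerivAt (fun t : ℝ => 1 - 2 * t) (-2) t := by
      simpa using ((hasDerivAt_id t).const_mul 2).const_sub 1
    have := (hd.rpow_const (p := -(a / 2) - k) (Or.inl (by linarith : (1 - 2 * t) ≠ 0))).const_mul (rprod a k)
    rw [this.deriv]
    have e : (-(a / 2) - ((k + 1 : ℕ) : ℝ)) = -(a / 2) - k - 1 := by push_cast; ring
    rw [e]
    unfold rprod
    rw [Finset.prod_range_succ]
    ring

lemma moment_sumsq (ι : Type*) [Fintype ι] (k : ℕ) :
    ∫⁻ x, ENNReal.ofReal ((∑ i, x i ^ 2) ^ k) ∂(gpi ι)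
      = ENNReal.ofReal (rprod (Fintype.card ι) k) := by
  have hI : ∀ t : ℝ, t < 1 / 2 → t ∈ integrableExpSet (fun x : ι → ℝ => ∑ i, x i ^ 2) (gpi ι) := by
    intro t ht
    refine Integrable.of_integral_ne_zero ?_
    have := mgf_sumsq ι t ht
    unfold mgf at this
    rw [this]
    exact (Real.rpow_pos_of_pos (by linarith) _).ne'
  have h0 : (0 : ℝ) ∈ interior (integrableExpSet (fun x : ι → ℝ => ∑ i, x i ^ 2) (gpi ι)) := by
    rw [mem_interior_iff_mem_nhds]
    filter_upwards [Iio_mem_nhds (by norm_num : (0 : ℝ) < 1 / 2)] with t ht using hI t ht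
  have h1 := iteratedDeriv_mgf_zero h0 k
  have hev : mgf (fun x : ι → ℝ => ∑ i, x i ^ 2) (gpi ι)
      =ᶠ[nhds 0] fun t => (1 - 2 * t) ^ (-(Fintype.card ι / 2) : ℝ) := by
    filter_upwards [Iio_mem_nhds (by norm_num : (0 : ℝ) < 1 / 2)] with t ht using mgf_sumsq ι t ht
  rw [hev.iteratedDeriv_eq, iterDeriv_aux _ _ _ (by norm_num)] at h1
  simp only [mul_zero, sub_zero, Real.one_rpow, mul_one] at h1
  rw [h1, ofReal_integral_eq_lintegral_ofReal]
  · rfl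
  · exact integrable_pow_of_mem_interior_integrableExpSet h0 k
  · exact ae_of_all _ fun x => by simp only [Pi.pow_apply, Pi.zero_apply]; positivity

/-- Image of the standard Gaussian under a matrix with orthonormal rows. -/
lemma gpi_map {ι κ : Type*} [Fintype ι] [Fintype κ] [DecidableEq κ] (A : Matrix κ ι ℝ)
    (hA : A * Aᵀ = 1) : (gpi ι).map (fun x => A *ᵥ x) = gpi κ := by
  classical
  have hm : Measurable (fun x : ι → ℝ => A *ᵥ x) :=
    (Continuous.matrix_mulVec continuous_const continuous_id).measurable
  have hinj : ((gpi ι).map (fun x => A *ᵥ x)).map (WithLp.toLp 2 : (κ → ℝ) → EuclideanSpace ℝ κ)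
      = (gpi κ).map (WithLp.toLp 2) := by
    have hk : (gpi κ).map (WithLp.toLp 2 : (κ → ℝ) → EuclideanSpace ℝ κ)
      = stdGaussian (EuclideanSpace ℝ κ) := map_pi_eq_stdGaussian
    have hi : (gpi ι).map (WithLp.toLp 2 : (ι → ℝ) → EuclideanSpace ℝ ι)
      = stdGaussian (EuclideanSpace ℝ ι) := map_pi_eq_stdGaussian
    rw [hk]
    rw [Measure.map_map (by fun_prop) hm]
    have : IsProbabilityMeasure ((gpi ι).map ((WithLp.toLp 2 : (κ → ℝ) → EuclideanSpace ℝ κ) ∘ (fun x => A *ᵥ x))) :=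
      Measure.isProbabilityMeasure_map (by fun_prop)
    apply Measure.ext_of_charFun (E := EuclideanSpace ℝ κ)
    ext t
    rw [charFun_stdGaussian, charFun_apply, integral_map (by fun_prop) (by fun_prop)]
    have h2 := charFun_stdGaussian (E := EuclideanSpace ℝ ι) (WithLp.toLp 2 (Aᵀ *ᵥ t.ofLp))
    rw [charFun_apply, ← hi, integral_map (by fun_prop) (by fun_prop)] at h2
    have hn : ‖(WithLp.toLp 2 (Aᵀ *ᵥ t.ofLp) : EuclideanSpace ℝ ι)‖ ^ 2 = ‖t‖ ^ 2 := by
      rw [EuclideanSpace.real_norm_sq_eq, EuclideanSpace.real_norm_sq_eq]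
      have : ∑ i, (Aᵀ *ᵥ t.ofLp) i ^ 2 = (Aᵀ *ᵥ t.ofLp) ⬝ᵥ (Aᵀ *ᵥ t.ofLp) := by
        simp [dotProduct, sq]
      simp only []
      rw [this, Matrix.dotProduct_mulVec, Matrix.vecMul_transpose, Matrix.mulVec_mulVec, hA, Matrix.one_mulVec]
      simp [dotProduct, sq]
    have hn' : (‖(WithLp.toLp 2 (Aᵀ *ᵥ t.ofLp) : EuclideanSpace ℝ ι)‖ : ℂ) ^ 2 = (‖t‖ : ℂ) ^ 2 := by
      exact_mod_cast hn
    rw [hn'] at h2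
    rw [← h2]
    congr 1
    ext x
    congr 3
    simp only [Function.comp, EuclideanSpace.inner_eq_star_dotProduct, star_trivial]
    rw [Matrix.dotProduct_mulVec, Matrix.mulVec_transpose]
  have := congrArg (Measure.map (WithLp.ofLp : EuclideanSpace ℝ κ → κ → ℝ)) hinj
  have e : ∀ ν : Measure (κ → ℝ), (ν.map (WithLp.toLp 2 : (κ → ℝ) → EuclideanSpace ℝ κ)).map
      (WithLp.ofLp : EuclideanSpace ℝ κ → κ → ℝ) = ν := by
    intro ν
    rw [Measure.map_map (by fun_prop) (by fun_prop)]
    exact Measure.map_id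
  rwa [e, e] at this

lemma moment_mulVec {ι κ : Type*} [Fintype ι] [Fintype κ] [DecidableEq κ] (A : Matrix κ ι ℝ)
    (hA : A * Aᵀ = 1) (k : ℕ) :
    ∫⁻ x, ENNReal.ofReal ((∑ i, (A *ᵥ x) i ^ 2) ^ k) ∂(gpi ι)
      = ENNReal.ofReal (rprod (Fintype.card κ) k) := by
  have hm : Measurable (fun x : ι → ℝ => A *ᵥ x) :=
    (Continuous.matrix_mulVec continuous_const continuous_id).measurable
  rw [← moment_sumsq κ k, ← gpi_map A hA, lintegral_map (by fun_prop) hm]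

lemma moment_lin {ι : Type*} [Fintype ι] (a : ι → ℝ) (k : ℕ) :
    ∫⁻ x, ENNReal.ofReal ((a ⬝ᵥ x) ^ (2 * k)) ∂(gpi ι)
      = ENNReal.ofReal ((a ⬝ᵥ a) ^ k * rprod 1 k) := by
  by_cases ha : a = 0
  · subst ha
    rcases Nat.eq_zero_or_pos k with rfl | hk
    · simp [rprod]
    · simp [hk.ne']
  have hpos : 0 < a ⬝ᵥ a := by
    have h0 : 0 ≤ a ⬝ᵥ a := by
      simp only [dotProduct]; exact Finset.sum_nonneg fun i _ => mul_self_nonneg _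
    exact lt_of_le_of_ne h0 (fun h => ha (dotProduct_self_eq_zero.1 h.symm))
  set s := Real.sqrt (a ⬝ᵥ a) with hs
  have hs2 : s ^ 2 = a ⬝ᵥ a := Real.sq_sqrt hpos.le
  have hs0 : 0 < s := Real.sqrt_pos.2 hpos
  have h := moment_mulVec (κ := Unit) (Matrix.of fun _ i => s⁻¹ * a i) (by
    ext i j
    simp only [Matrix.mul_apply, Matrix.of_apply, Matrix.transpose_apply, Matrix.one_apply]
    have : ∑ x, s⁻¹ * a x * (s⁻¹ * a x) = s⁻¹ ^ 2 * (a ⬝ᵥ a) := by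
      simp only [dotProduct, Finset.mul_sum]
      exact Finset.sum_congr rfl fun i _ => by ring
    rw [this, ← hs2]
    simp [hs0.ne']) k
  simp only [Fintype.card_unit, Nat.cast_one, Finset.univ_unique, Finset.sum_singleton] at h
  rw [ENNReal.ofReal_mul (by positivity), ← h, ← lintegral_const_mul' _ _ ENNReal.ofReal_ne_top]
  congr 1
  ext x
  rw [← ENNReal.ofReal_mul (by positivity)]
  congr 1
  have : ((Matrix.of fun (_ : Unit) i => s⁻¹ * a i) *ᵥ x) default = s⁻¹ * (a ⬝ᵥ x) := by
    simp only [Matrix.mulVec, dotProduct, Matrix.of_apply, Finset.mul_sum]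
    exact Finset.sum_congr rfl fun i _ => by ring
  rw [this, ← hs2]
  rw [pow_mul, ← mul_pow]
  congr 1
  field_simp

lemma dot_self_nonneg' {ι : Type*} [Fintype ι] (x : ι → ℝ) : 0 ≤ x ⬝ᵥ x := by
  simp only [dotProduct]; exact Finset.sum_nonneg fun i _ => mul_self_nonneg _

lemma dot_self_sq {ι : Type*} [Fintype ι] (x : ι → ℝ) : x ⬝ᵥ x = ∑ i, x i ^ 2 := by
  simp [dotProduct, sq]

lemma rprod_nonneg {a : ℝ} (ha : 0 ≤ a) (k : ℕ) : 0 ≤ rprod a k :=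
  Finset.prod_nonneg fun j _ => by positivity

lemma rprod_pos {a : ℝ} (ha : 0 < a) (k : ℕ) : 0 < rprod a k :=
  Finset.prod_pos fun j _ => by positivity

lemma householder {ι : Type*} [Fintype ι] [DecidableEq ι] (x y y' : ι → ℝ)
    (h1 : x ⬝ᵥ y = x ⬝ᵥ y') (h2 : y ⬝ᵥ y = y' ⬝ᵥ y') :
    ∃ O : Matrix ι ι ℝ, O * Oᵀ = 1 ∧ O *ᵥ x = x ∧ O *ᵥ y = y' := by
  by_cases hyy : y = y'
  · subst hyy
    exact ⟨1, by simp, by simp, by simp⟩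
  set w := y - y' with hw
  have hw0 : w ⬝ᵥ w ≠ 0 := by
    intro h
    exact hyy (sub_eq_zero.1 (dotProduct_self_eq_zero.1 h))
  have hww : w ⬝ᵥ w = 2 * (w ⬝ᵥ y) := by
    simp only [hw, sub_dotProduct, dotProduct_sub]
    rw [dotProduct_comm y' y]; linarith
  have hwx : w ⬝ᵥ x = 0 := by
    rw [dotProduct_comm]; simp only [hw, dotProduct_sub]; linarith
  have hv : ∀ v, (1 - (2 / (w ⬝ᵥ w)) • Matrix.vecMulVec w w) *ᵥ v
      = v - ((2 / (w ⬝ᵥ w)) * (w ⬝ᵥ v)) • w := by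
    intro v
    rw [Matrix.sub_mulVec, Matrix.one_mulVec, Matrix.smul_mulVec, Matrix.vecMulVec_mulVec]
    ext i
    simp
    ring
  refine ⟨1 - (2 / (w ⬝ᵥ w)) • Matrix.vecMulVec w w, ?_, ?_, ?_⟩
  · rw [Matrix.transpose_sub, Matrix.transpose_one, Matrix.transpose_smul,
      Matrix.transpose_vecMulVec]
    rw [sub_mul, mul_sub, mul_sub, one_mul, one_mul, mul_one, Matrix.smul_mul, Matrix.mul_smul,
      Matrix.vecMulVec_mul_vecMulVec]
    ext i j
    simp [Matrix.vecMulVec_apply]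
    field_simp
    ring
  · rw [hv, hwx]; simp
  · rw [hv]
    have : 2 / (w ⬝ᵥ w) * (w ⬝ᵥ y) = 1 := by
      rw [← mul_div_right_comm, hww]; rw [hww] at hw0; exact div_self hw0
    rw [this, hw]; simp

lemma meas_entry {m n : Type*} (i : m) (j : n) :
    Measurable (fun W : Matrix m n ℝ => W i j) :=
  (measurable_pi_apply j).comp (measurable_pi_apply i)

section Stiefel

set_option linter.unusedSectionVars false

variable {Ω ι : Type*} [MeasurableSpace Ω] [Fintype ι] [DecidableEq ι] {P : Measure Ω}
  [IsProbabilityMeasure P] {n : ℕ} {V : Ω → Matrix (Fin n) ι ℝ}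

lemma stiefel_inv (hV : IsUniformStiefel P V) (x y y' : ι → ℝ)
    (h1 : x ⬝ᵥ y = x ⬝ᵥ y') (h2 : y ⬝ᵥ y = y' ⬝ᵥ y')
    (f : (Fin n → ℝ) → (Fin n → ℝ) → ℝ≥0∞)
    (hf : Measurable (fun W : Matrix (Fin n) ι ℝ => f (W *ᵥ x) (W *ᵥ y))) :
    ∫⁻ ω, f (V ω *ᵥ x) (V ω *ᵥ y) ∂P = ∫⁻ ω, f (V ω *ᵥ x) (V ω *ᵥ y') ∂P := by
  obtain ⟨O, hO, hx, hy⟩ := householder x y y' h1 h2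
  have hinv := hV.2.2 O hO
  have hVO : Measurable (fun ω => V ω * O) := by
    refine measurable_pi_lambda _ fun i => measurable_pi_lambda _ fun j => ?_
    have : ∀ i j, Measurable (fun ω => V ω i j) := fun i j => (meas_entry i j).comp hV.1
    simp only [Matrix.mul_apply]
    fun_prop
  rw [← lintegral_map hf hV.1, ← hinv, lintegral_map hf hVO]
  simp only [← Matrix.mulVec_mulVec, hx, hy]

lemma norm_moment (hV : IsUniformStiefel P V) (x : ι → ℝ) (k : ℕ) :
    (∫⁻ ω, ENNReal.ofReal (((V ω *ᵥ x) ⬝ᵥ (V ω *ᵥ x)) ^ k) ∂P)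
        * ENNReal.ofReal (rprod (Fintype.card ι) k)
      = ENNReal.ofReal ((x ⬝ᵥ x) ^ k * rprod n k) := by
  have hVm : ∀ i j, Measurable (fun ω => V ω i j) := fun i j => (meas_entry i j).comp hV.1
  have hE : ∀ (i : Fin n) (j : ι), Measurable (fun W : Matrix (Fin n) ι ℝ => W i j) := meas_entry
  have key : ∀ g : ι → ℝ, (∫⁻ ω, ENNReal.ofReal (((V ω *ᵥ x) ⬝ᵥ (V ω *ᵥ x)) ^ k) ∂P)
        * ENNReal.ofReal ((g ⬝ᵥ g) ^ k)
      = ENNReal.ofReal ((x ⬝ᵥ x) ^ k)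
        * ∫⁻ ω, ENNReal.ofReal (((V ω *ᵥ g) ⬝ᵥ (V ω *ᵥ g)) ^ k) ∂P := by
    intro g
    have hg := dot_self_nonneg' g
    have hx := dot_self_nonneg' x
    have h := stiefel_inv hV 0 (Real.sqrt (g ⬝ᵥ g) • x) (Real.sqrt (x ⬝ᵥ x) • g) (by simp) (by
        simp only [smul_dotProduct, dotProduct_smul, smul_eq_mul, ← mul_assoc,
          Real.mul_self_sqrt hg, Real.mul_self_sqrt hx]
        ring) (fun _ b => ENNReal.ofReal ((b ⬝ᵥ b) ^ k)) (by
        simp only [Matrix.mulVec, dotProduct]; fun_prop)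
    have e : ∀ (s : ℝ) (hs : 0 ≤ s) (v : ι → ℝ) ω, ENNReal.ofReal
        (((V ω *ᵥ (Real.sqrt s • v)) ⬝ᵥ (V ω *ᵥ (Real.sqrt s • v))) ^ k)
        = ENNReal.ofReal (s ^ k) * ENNReal.ofReal (((V ω *ᵥ v) ⬝ᵥ (V ω *ᵥ v)) ^ k) := by
      intro s hs v ω
      rw [← ENNReal.ofReal_mul (by positivity), ← mul_pow]
      simp only [Matrix.mulVec_smul, smul_dotProduct, dotProduct_smul, smul_eq_mul, ← mul_assoc,
          Real.mul_self_sqrt hs]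
    simp only [e _ hg, e _ hx] at h
    rw [lintegral_const_mul' _ _ ENNReal.ofReal_ne_top,
      lintegral_const_mul' _ _ ENNReal.ofReal_ne_top] at h
    rw [mul_comm]; exact h
  have h2 := moment_sumsq ι k
  simp only [← dot_self_sq] at h2
  rw [← h2, ← lintegral_const_mul _ (by simp only [dotProduct]; fun_prop)]
  simp only [key]
  rw [lintegral_const_mul' _ _ ENNReal.ofReal_ne_top, ENNReal.ofReal_mul
    (pow_nonneg (dot_self_nonneg' x) k)]
  congr 1
  rw [lintegral_lintegral_swap]
  · have : ∀ᵐ ω ∂P, ∫⁻ g, ENNReal.ofReal (((V ω *ᵥ g) ⬝ᵥ (V ω *ᵥ g)) ^ k) ∂(gpi ι)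
        = ENNReal.ofReal (rprod n k) := by
      filter_upwards [hV.2.1] with ω hω
      have := moment_mulVec (V ω) hω k
      simp only [← dot_self_sq, Fintype.card_fin] at this
      exact this
    rw [lintegral_congr_ae this]; simp
  · apply Measurable.aemeasurable
    have hVm2 : ∀ i j, Measurable (fun q : (ι → ℝ) × Ω => V q.2 i j) :=
      fun i j => (hVm i j).comp measurable_snd
    simp only [Function.uncurry_def, Matrix.mulVec, dotProduct]
    fun_prop

lemma cross_moment (hV : IsUniformStiefel P V) {σ : Type*} [Fintype σ] [DecidableEq σ]
    (E : Matrix ι σ ℝ) (hE : Eᵀ * E = 1)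
    (x y : ι → ℝ) (hx : Eᵀ *ᵥ x = 0) (hxy : x ⬝ᵥ y = 0) (k : ℕ) :
    (∫⁻ ω, ENNReal.ofReal (((V ω *ᵥ x) ⬝ᵥ (V ω *ᵥ y)) ^ (2 * k)) ∂P)
        * ENNReal.ofReal (rprod (Fintype.card σ) k)
      ≤ ENNReal.ofReal ((y ⬝ᵥ y) ^ k * rprod 1 k)
        * ∫⁻ ω, ENNReal.ofReal (((V ω *ᵥ x) ⬝ᵥ (V ω *ᵥ x)) ^ k) ∂P := by
  have hVm : ∀ i j, Measurable (fun ω => V ω i j) := fun i j => (meas_entry i j).comp hV.1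
  have hEnt : ∀ (i : Fin n) (j : ι), Measurable (fun W : Matrix (Fin n) ι ℝ => W i j) := meas_entry
  have hEE : ∀ h : σ → ℝ, (E *ᵥ h) ⬝ᵥ (E *ᵥ h) = h ⬝ᵥ h := by
    intro h
    rw [Matrix.dotProduct_mulVec, ← Matrix.mulVec_transpose, Matrix.mulVec_mulVec, hE,
      Matrix.one_mulVec]
  have hxE : ∀ h : σ → ℝ, x ⬝ᵥ (E *ᵥ h) = 0 := by
    intro h
    rw [Matrix.dotProduct_mulVec, ← Matrix.mulVec_transpose, hx, zero_dotProduct]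
  have key : ∀ g : σ → ℝ, (∫⁻ ω, ENNReal.ofReal (((V ω *ᵥ x) ⬝ᵥ (V ω *ᵥ y)) ^ (2 * k)) ∂P)
        * ENNReal.ofReal ((g ⬝ᵥ g) ^ k)
      = ENNReal.ofReal ((y ⬝ᵥ y) ^ k)
        * ∫⁻ ω, ENNReal.ofReal (((V ω *ᵥ x) ⬝ᵥ (V ω *ᵥ (E *ᵥ g))) ^ (2 * k)) ∂P := by
    intro g
    have hg := dot_self_nonneg' g
    have hy := dot_self_nonneg' y
    have h := stiefel_inv hV x (Real.sqrt (g ⬝ᵥ g) • y) (Real.sqrt (y ⬝ᵥ y) • (E *ᵥ g))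
      (by simp [dotProduct_smul, hxE, hxy]) (by
        simp only [smul_dotProduct, dotProduct_smul, smul_eq_mul, ← mul_assoc,
          Real.mul_self_sqrt hg, Real.mul_self_sqrt hy, hEE]
        ring) (fun a b => ENNReal.ofReal ((a ⬝ᵥ b) ^ (2 * k))) (by
        simp only [Matrix.mulVec, dotProduct]; fun_prop)
    have e : ∀ (s : ℝ) (hs : 0 ≤ s) (v : ι → ℝ) ω, ENNReal.ofReal
        (((V ω *ᵥ x) ⬝ᵥ (V ω *ᵥ (Real.sqrt s • v))) ^ (2 * k))
        = ENNReal.ofReal (s ^ k) * ENNReal.ofReal (((V ω *ᵥ x) ⬝ᵥ (V ω *ᵥ v)) ^ (2 * k)) := by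
      intro s hs v ω
      rw [← ENNReal.ofReal_mul (by positivity)]
      simp only [Matrix.mulVec_smul, dotProduct_smul, smul_eq_mul]
      rw [mul_pow, pow_mul (Real.sqrt s), Real.sq_sqrt hs]
    simp only [e _ hg, e _ hy] at h
    rw [lintegral_const_mul' _ _ ENNReal.ofReal_ne_top,
      lintegral_const_mul' _ _ ENNReal.ofReal_ne_top] at h
    rw [mul_comm]; exact h
  have h2 := moment_sumsq σ k
  simp only [← dot_self_sq] at h2
  rw [← h2, ← lintegral_const_mul _ (by simp only [dotProduct]; fun_prop)]
  simp only [key]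
  rw [lintegral_const_mul' _ _ ENNReal.ofReal_ne_top, ENNReal.ofReal_mul
    (pow_nonneg (dot_self_nonneg' y) k), mul_assoc]
  gcongr
  rw [lintegral_lintegral_swap]
  · rw [← lintegral_const_mul' _ _ ENNReal.ofReal_ne_top]
    apply lintegral_mono_ae
    filter_upwards [hV.2.1] with ω hω
    set u := (V ω)ᵀ *ᵥ (V ω *ᵥ x) with hu
    have e1 : ∀ g : σ → ℝ, (V ω *ᵥ x) ⬝ᵥ (V ω *ᵥ (E *ᵥ g)) = (Eᵀ *ᵥ u) ⬝ᵥ g := by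
      intro g
      rw [Matrix.dotProduct_mulVec, ← Matrix.mulVec_transpose, Matrix.dotProduct_mulVec,
        ← Matrix.mulVec_transpose]
    simp only [e1]
    rw [moment_lin, ← ENNReal.ofReal_mul (rprod_nonneg zero_le_one k), mul_comm]
    have e2 : u ⬝ᵥ u = (V ω *ᵥ x) ⬝ᵥ (V ω *ᵥ x) := by
      conv_lhs => rw [hu]
      rw [Matrix.dotProduct_mulVec, Matrix.vecMul_transpose, Matrix.mulVec_mulVec, hω,
        Matrix.one_mulVec]
    have e3 : (Eᵀ *ᵥ u) ⬝ᵥ (Eᵀ *ᵥ u) ≤ u ⬝ᵥ u := by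
      have h0 := dot_self_nonneg' (u - E *ᵥ (Eᵀ *ᵥ u))
      have h3 : u ⬝ᵥ (E *ᵥ (Eᵀ *ᵥ u)) = (Eᵀ *ᵥ u) ⬝ᵥ (Eᵀ *ᵥ u) := by
        rw [Matrix.dotProduct_mulVec, ← Matrix.mulVec_transpose]
      simp only [sub_dotProduct, dotProduct_sub] at h0
      rw [dotProduct_comm (E *ᵥ (Eᵀ *ᵥ u)) u, hEE, h3] at h0
      linarith
    rw [← e2]
    apply ENNReal.ofReal_le_ofReal
    have h0 := dot_self_nonneg' (Eᵀ *ᵥ u)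
    have := rprod_nonneg zero_le_one k
    gcongr
  · apply Measurable.aemeasurable
    have hVm2 : ∀ i j, Measurable (fun q : (σ → ℝ) × Ω => V q.2 i j) :=
      fun i j => (hVm i j).comp measurable_snd
    simp only [Function.uncurry_def, Matrix.mulVec, dotProduct]
    fun_prop

end Stiefel

lemma euclid_apply_norm_sq {m n : Type*} [Fintype m] [Fintype n] [DecidableEq n]
    (M : Matrix m n ℝ) (v : EuclideanSpace ℝ n) :
    ‖Matrix.toEuclideanLin M v‖ ^ 2 = (M *ᵥ v.ofLp) ⬝ᵥ (M *ᵥ v.ofLp) := by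
  rw [EuclideanSpace.real_norm_sq_eq, dot_self_sq]
  rfl

lemma pointwise_dir {τ δ : Type*} [Fintype τ] [Fintype δ] (M : Matrix τ δ ℝ) (k : ℕ) (v : δ → ℝ) :
    ENNReal.ofReal (((M *ᵥ v) ⬝ᵥ (M *ᵥ v)) ^ k * rprod 1 k ^ 2)
      ≤ ENNReal.ofReal ((v ⬝ᵥ v) ^ k) *
        ∫⁻ x, ∫⁻ y, ENNReal.ofReal ((x ⬝ᵥ (M *ᵥ y)) ^ (2 * k)) ∂(gpi δ) ∂(gpi τ) := by
  have hr := rprod_nonneg zero_le_one k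
  have h1 : ∀ x : τ → ℝ, ∫⁻ y, ENNReal.ofReal ((x ⬝ᵥ (M *ᵥ y)) ^ (2 * k)) ∂(gpi δ)
      = ENNReal.ofReal (((Mᵀ *ᵥ x) ⬝ᵥ (Mᵀ *ᵥ x)) ^ k * rprod 1 k) := by
    intro x
    rw [← moment_lin]
    simp only [Matrix.dotProduct_mulVec, Matrix.mulVec_transpose]
  simp only [h1]
  rw [← lintegral_const_mul' _ _ ENNReal.ofReal_ne_top]
  have h2 : ENNReal.ofReal (((M *ᵥ v) ⬝ᵥ (M *ᵥ v)) ^ k * rprod 1 k ^ 2)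
      = ∫⁻ x, ENNReal.ofReal (rprod 1 k) * ENNReal.ofReal (((M *ᵥ v) ⬝ᵥ x) ^ (2 * k)) ∂(gpi τ) := by
    rw [lintegral_const_mul' _ _ ENNReal.ofReal_ne_top, moment_lin, ← ENNReal.ofReal_mul hr]
    congr 1; ring
  rw [h2]
  apply lintegral_mono
  intro x
  simp only
  have hv := dot_self_nonneg' v
  rw [← ENNReal.ofReal_mul hr, ← ENNReal.ofReal_mul (by positivity)]
  apply ENNReal.ofReal_le_ofReal
  have h3 : (M *ᵥ v) ⬝ᵥ x = (Mᵀ *ᵥ x) ⬝ᵥ v := by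
    rw [dotProduct_comm, Matrix.dotProduct_mulVec, Matrix.mulVec_transpose]
  have h4 : ((Mᵀ *ᵥ x) ⬝ᵥ v) ^ 2 ≤ (v ⬝ᵥ v) * ((Mᵀ *ᵥ x) ⬝ᵥ (Mᵀ *ᵥ x)) := by
    have := Finset.sum_mul_sq_le_sq_mul_sq Finset.univ (Mᵀ *ᵥ x) v
    rw [dot_self_sq, dot_self_sq, mul_comm]
    exact this
  rw [h3, pow_mul]
  calc rprod 1 k * (((Mᵀ *ᵥ x) ⬝ᵥ v) ^ 2) ^ k
      ≤ rprod 1 k * ((v ⬝ᵥ v) * ((Mᵀ *ᵥ x) ⬝ᵥ (Mᵀ *ᵥ x))) ^ k := by gcongr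
    _ = _ := by rw [mul_pow]; ring

lemma specNorm_pointwise {τ δ : Type*} [Fintype τ] [Fintype δ] [DecidableEq δ]
    (M : Matrix τ δ ℝ) (k : ℕ) (hk : k ≠ 0) :
    ENNReal.ofReal (specNorm M ^ (2 * k) * rprod 1 k ^ 2)
      ≤ ∫⁻ x, ∫⁻ y, ENNReal.ofReal ((x ⬝ᵥ (M *ᵥ y)) ^ (2 * k)) ∂(gpi δ) ∂(gpi τ) := by
  set Φ := ∫⁻ x, ∫⁻ y, ENNReal.ofReal ((x ⬝ᵥ (M *ᵥ y)) ^ (2 * k)) ∂(gpi δ) ∂(gpi τ) with hΦ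
  by_cases htop : Φ = ⊤
  · rw [htop]; exact le_top
  have hr := rprod_pos zero_lt_one k
  set a := Φ.toReal / rprod 1 k ^ 2 with ha
  have ha0 : 0 ≤ a := by positivity
  have h2k : 2 * k ≠ 0 := by omega
  set b := a ^ (((2 * k : ℕ) : ℝ)⁻¹) with hb
  have hb0 : 0 ≤ b := by positivity
  have hbk : b ^ (2 * k) = a := Real.rpow_inv_natCast_pow ha0 h2k
  have hspec : specNorm M ≤ b := by
    unfold specNorm
    refine ContinuousLinearMap.opNorm_le_bound _ hb0 fun v => ?_
    have h := pointwise_dir M k v.ofLp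
    rw [← hΦ, ← ENNReal.ofReal_toReal htop,
      ← ENNReal.ofReal_mul (pow_nonneg (dot_self_nonneg' _) _),
      ENNReal.ofReal_le_ofReal_iff (mul_nonneg (pow_nonneg (dot_self_nonneg' _) _)
        ENNReal.toReal_nonneg), ← euclid_apply_norm_sq] at h
    have hv : v.ofLp ⬝ᵥ v.ofLp = ‖v‖ ^ 2 := by
      rw [EuclideanSpace.real_norm_sq_eq, dot_self_sq]
    rw [hv, ← pow_mul, ← pow_mul] at h
    rw [LinearMap.coe_toContinuousLinearMap']
    refine (pow_le_pow_iff_left₀ (norm_nonneg _) (by positivity) h2k).1 ?_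
    rw [mul_pow, hbk, ha, div_mul_eq_mul_div, le_div_iff₀ (by positivity)]
    linarith
  have h0 : 0 ≤ specNorm M := norm_nonneg _
  calc ENNReal.ofReal (specNorm M ^ (2 * k) * rprod 1 k ^ 2)
      ≤ ENNReal.ofReal (a * rprod 1 k ^ 2) := by
        apply ENNReal.ofReal_le_ofReal
        rw [← hbk]; gcongr
    _ = ENNReal.ofReal Φ.toReal := by rw [ha]; congr 1; field_simp
    _ = Φ := ENNReal.ofReal_toReal htop

section Expected

variable {Ω ι : Type*} [MeasurableSpace Ω] [Fintype ι] [DecidableEq ι] {P : Measure Ω}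
  [IsProbabilityMeasure P] {n : ℕ} {V : Ω → Matrix (Fin n) ι ℝ}

lemma expected_bound (hV : IsUniformStiefel P V)
    {τ δ σ : Type*} [Fintype τ] [Fintype δ] [Fintype σ]
    [DecidableEq τ] [DecidableEq δ] [DecidableEq σ]
    (F : Matrix ι τ ℝ) (G : Matrix ι δ ℝ) (E : Matrix ι σ ℝ)
    (hF : Fᵀ * F = 1) (hG : Gᵀ * G = 1) (hE : Eᵀ * E = 1) (hFG : Fᵀ * G = 0) (hEF : Eᵀ * F = 0)
    (k : ℕ) :
    (∫⁻ ω, (∫⁻ x, ∫⁻ y, ENNReal.ofReal ((x ⬝ᵥ (((V ω * F)ᵀ * (V ω * G)) *ᵥ y)) ^ (2 * k))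
        ∂(gpi δ) ∂(gpi τ)) ∂P)
      * ENNReal.ofReal (rprod (Fintype.card σ) k * rprod (Fintype.card ι) k)
      ≤ ENNReal.ofReal (rprod (Fintype.card τ) k * rprod (Fintype.card δ) k * rprod 1 k
          * rprod n k) := by
  have hVm : ∀ i j, Measurable (fun ω => V ω i j) := fun i j => (meas_entry i j).comp hV.1
  have e0 : ∀ ω (x : τ → ℝ) (y : δ → ℝ), x ⬝ᵥ (((V ω * F)ᵀ * (V ω * G)) *ᵥ y)
      = (V ω *ᵥ (F *ᵥ x)) ⬝ᵥ (V ω *ᵥ (G *ᵥ y)) := by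
    intro ω x y
    rw [← Matrix.mulVec_mulVec, Matrix.dotProduct_mulVec, Matrix.vecMul_transpose,
      ← Matrix.mulVec_mulVec, ← Matrix.mulVec_mulVec]
  simp only [e0]
  have hm3 : Measurable (fun q : (Ω × (τ → ℝ)) × (δ → ℝ) => ENNReal.ofReal
      (((V q.1.1 *ᵥ (F *ᵥ q.1.2)) ⬝ᵥ (V q.1.1 *ᵥ (G *ᵥ q.2))) ^ (2 * k))) := by
    have hVm2 : ∀ i j, Measurable (fun q : (Ω × (τ → ℝ)) × (δ → ℝ) => V q.1.1 i j) :=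
      fun i j => (hVm i j).comp (measurable_fst.comp measurable_fst)
    simp only [Matrix.mulVec, dotProduct]
    fun_prop
  have hcard : (0 : ℝ) ≤ Fintype.card ι := by positivity
  have hr1 := rprod_nonneg zero_le_one k
  rw [lintegral_lintegral_swap]
  swap
  · exact (hm3.lintegral_prod_right').aemeasurable
  have step : ∀ x : τ → ℝ, ∫⁻ ω, ∫⁻ y, ENNReal.ofReal
      (((V ω *ᵥ (F *ᵥ x)) ⬝ᵥ (V ω *ᵥ (G *ᵥ y))) ^ (2 * k)) ∂(gpi δ) ∂P
      = ∫⁻ y, ∫⁻ ω, ENNReal.ofReal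
      (((V ω *ᵥ (F *ᵥ x)) ⬝ᵥ (V ω *ᵥ (G *ᵥ y))) ^ (2 * k)) ∂P ∂(gpi δ) := by
    intro x
    apply lintegral_lintegral_swap
    apply Measurable.aemeasurable
    exact hm3.comp (f := fun q : Ω × (δ → ℝ) => ((q.1, x), q.2)) (by fun_prop)
  simp only [step]
  have hxx : ∀ x : τ → ℝ, (F *ᵥ x) ⬝ᵥ (F *ᵥ x) = x ⬝ᵥ x := by
    intro h
    rw [Matrix.dotProduct_mulVec, ← Matrix.mulVec_transpose, Matrix.mulVec_mulVec, hF,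
      Matrix.one_mulVec]
  have hyy : ∀ y : δ → ℝ, (G *ᵥ y) ⬝ᵥ (G *ᵥ y) = y ⬝ᵥ y := by
    intro h
    rw [Matrix.dotProduct_mulVec, ← Matrix.mulVec_transpose, Matrix.mulVec_mulVec, hG,
      Matrix.one_mulVec]
  have hxy : ∀ (x : τ → ℝ) (y : δ → ℝ), (F *ᵥ x) ⬝ᵥ (G *ᵥ y) = 0 := by
    intro x y
    rw [dotProduct_comm, Matrix.dotProduct_mulVec, ← Matrix.mulVec_transpose,
      Matrix.mulVec_mulVec]
    have : Fᵀ * G = 0 := hFG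
    rw [this]; simp
  have main : ∀ (x : τ → ℝ) (y : δ → ℝ), (∫⁻ ω, ENNReal.ofReal
      (((V ω *ᵥ (F *ᵥ x)) ⬝ᵥ (V ω *ᵥ (G *ᵥ y))) ^ (2 * k)) ∂P)
      * ENNReal.ofReal (rprod (Fintype.card σ) k * rprod (Fintype.card ι) k)
      ≤ ENNReal.ofReal ((x ⬝ᵥ x) ^ k) * (ENNReal.ofReal ((y ⬝ᵥ y) ^ k)
        * ENNReal.ofReal (rprod 1 k * rprod n k)) := by
    intro x y
    have h1 := cross_moment hV E hE (F *ᵥ x) (G *ᵥ y)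
      (by rw [Matrix.mulVec_mulVec, hEF]; simp) (hxy x y) k
    have h2 := norm_moment hV (F *ᵥ x) k
    rw [hxx] at h2
    rw [hyy] at h1
    rw [ENNReal.ofReal_mul (rprod_nonneg (by positivity) k), ← mul_assoc]
    calc _ ≤ _ := mul_le_mul_left h1 _
      _ = _ := by
        rw [mul_assoc, h2]
        have hx0 := dot_self_nonneg' x
        have hy0 := dot_self_nonneg' y
        have hn := rprod_nonneg (Nat.cast_nonneg (α := ℝ) n) k
        rw [← ENNReal.ofReal_mul (by positivity), ← ENNReal.ofReal_mul (by positivity),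
          ← ENNReal.ofReal_mul (by positivity)]
        congr 1; ring
  have hxi := moment_sumsq τ k
  have hyi := moment_sumsq δ k
  simp only [← dot_self_sq] at hxi hyi
  rw [← lintegral_mul_const' _ _ ENNReal.ofReal_ne_top]
  have inner : ∀ x : τ → ℝ, (∫⁻ y, ∫⁻ ω, ENNReal.ofReal
      (((V ω *ᵥ (F *ᵥ x)) ⬝ᵥ (V ω *ᵥ (G *ᵥ y))) ^ (2 * k)) ∂P ∂(gpi δ))
      * ENNReal.ofReal (rprod (Fintype.card σ) k * rprod (Fintype.card ι) k)
      ≤ ENNReal.ofReal ((x ⬝ᵥ x) ^ k) * (ENNReal.ofReal (rprod (Fintype.card δ) k)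
        * ENNReal.ofReal (rprod 1 k * rprod n k)) := by
    intro x
    rw [← lintegral_mul_const' _ _ ENNReal.ofReal_ne_top, ← hyi,
      ← lintegral_mul_const' _ _ ENNReal.ofReal_ne_top,
      ← lintegral_const_mul' _ _ ENNReal.ofReal_ne_top]
    exact lintegral_mono fun y => main x y
  refine (lintegral_mono inner).trans ?_
  have hn := rprod_nonneg (Nat.cast_nonneg (α := ℝ) n) k
  have hd := rprod_nonneg (Nat.cast_nonneg (α := ℝ) (Fintype.card δ)) k
  have ht := rprod_nonneg (Nat.cast_nonneg (α := ℝ) (Fintype.card τ)) k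
  rw [lintegral_mul_const' _ _ (by
    rw [← ENNReal.ofReal_mul hd]; exact ENNReal.ofReal_ne_top), hxi,
    ← ENNReal.ofReal_mul hd, ← ENNReal.ofReal_mul ht]
  apply le_of_eq; congr 1; ring

/-- Tail bound by the Markov inequality. -/
lemma tail_bound (hV : IsUniformStiefel P V)
    {τ δ σ : Type*} [Fintype τ] [Fintype δ] [Fintype σ]
    [DecidableEq τ] [DecidableEq δ] [DecidableEq σ]
    (F : Matrix ι τ ℝ) (G : Matrix ι δ ℝ) (E : Matrix ι σ ℝ)
    (hF : Fᵀ * F = 1) (hG : Gᵀ * G = 1) (hE : Eᵀ * E = 1) (hFG : Fᵀ * G = 0) (hEF : Eᵀ * F = 0)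
    (k : ℕ) (hk : k ≠ 0) (c : ℝ) (hc : 0 < c)
    (hσ : 0 < Fintype.card σ) (hι : 0 < Fintype.card ι) :
    P {ω | c ≤ specNorm ((V ω * F)ᵀ * (V ω * G))}
      ≤ ENNReal.ofReal (rprod (Fintype.card τ) k * rprod (Fintype.card δ) k * rprod n k
        / (c ^ (2 * k) * rprod 1 k * rprod (Fintype.card σ) k * rprod (Fintype.card ι) k)) := by
  have hVm : ∀ i j, Measurable (fun ω => V ω i j) := fun i j => (meas_entry i j).comp hV.1
  set Φ : Ω → ℝ≥0∞ := fun ω => ∫⁻ x, ∫⁻ y, ENNReal.ofReal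
    ((x ⬝ᵥ (((V ω * F)ᵀ * (V ω * G)) *ᵥ y)) ^ (2 * k)) ∂(gpi δ) ∂(gpi τ) with hΦ
  have hΦm : Measurable Φ := by
    have hm3 : Measurable (fun q : (Ω × (τ → ℝ)) × (δ → ℝ) => ENNReal.ofReal
        ((q.1.2 ⬝ᵥ (((V q.1.1 * F)ᵀ * (V q.1.1 * G)) *ᵥ q.2)) ^ (2 * k))) := by
      have hVm2 : ∀ i j, Measurable (fun q : (Ω × (τ → ℝ)) × (δ → ℝ) => V q.1.1 i j) :=
        fun i j => (hVm i j).comp (measurable_fst.comp measurable_fst)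
      simp only [Matrix.mulVec, dotProduct, Matrix.mul_apply, Matrix.transpose_apply]
      fun_prop
    exact (hm3.lintegral_prod_right').lintegral_prod_right'
  have hexp := expected_bound hV F G E hF hG hE hFG hEF k
  have r1 := rprod_pos zero_lt_one k
  have rσ := rprod_pos (Nat.cast_pos (α := ℝ).2 hσ) k
  have rι := rprod_pos (Nat.cast_pos (α := ℝ).2 hι) k
  set ε := ENNReal.ofReal (c ^ (2 * k) * rprod 1 k ^ 2) with hε
  have hsub : {ω | c ≤ specNorm ((V ω * F)ᵀ * (V ω * G))} ⊆ {ω | ε ≤ Φ ω} := by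
    intro ω hω
    refine le_trans (ENNReal.ofReal_le_ofReal ?_) (specNorm_pointwise _ k hk)
    have : c ≤ specNorm ((V ω * F)ᵀ * (V ω * G)) := hω
    gcongr
  have hmk := mul_meas_ge_le_lintegral (μ := P) hΦm ε
  have h3 : P {ω | c ≤ specNorm ((V ω * F)ᵀ * (V ω * G))} * ENNReal.ofReal
      (c ^ (2 * k) * rprod 1 k ^ 2 * (rprod (Fintype.card σ) k * rprod (Fintype.card ι) k))
      ≤ ENNReal.ofReal (rprod (Fintype.card τ) k * rprod (Fintype.card δ) k * rprod 1 k
          * rprod n k) := by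
    refine le_trans ?_ hexp
    rw [ENNReal.ofReal_mul (by positivity), ← mul_assoc]
    gcongr
    refine le_trans ?_ hmk
    rw [mul_comm]
    gcongr
  rw [← ENNReal.le_div_iff_mul_le (Or.inl (by
      rw [ne_eq, ENNReal.ofReal_eq_zero, not_le]; positivity)) (Or.inl ENNReal.ofReal_ne_top),
    ← ENNReal.ofReal_div_of_pos (by positivity)] at h3
  refine h3.trans (le_of_eq ?_)
  congr 1
  field_simp

end Expected


lemma rprod_succ (a : ℝ) (k : ℕ) : rprod a (k + 1) = rprod a k * (a + 2 * k) := by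
  simp [rprod, Finset.prod_range_succ]

lemma one_add_inv_pow (k : ℕ) (hk : 0 < k) : (1 + 1 / (k : ℝ)) ^ k ≤ Real.exp 1 := by
  have hk' : (0 : ℝ) < k := Nat.cast_pos.2 hk
  have h1 : 1 + 1 / (k : ℝ) ≤ Real.exp (1 / k) := by
    have := Real.add_one_le_exp (1 / (k : ℝ)); linarith
  calc (1 + 1 / (k : ℝ)) ^ k ≤ (Real.exp (1 / k)) ^ k := by gcongr
    _ = Real.exp 1 := by rw [← Real.exp_nat_mul]; congr 1; field_simp

lemma rprod_one_lower (k : ℕ) (hk : 5 ≤ k) : (2 * (k : ℝ) / 3) ^ k ≤ rprod 1 k := by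
  induction k, hk using Nat.le_induction with
  | base => norm_num [rprod, Finset.prod_range_succ]
  | succ k hk ih =>
    have hk5 : (5 : ℝ) ≤ k := by exact_mod_cast hk
    have hk0 : (0 : ℝ) < k := by linarith
    have he := one_add_inv_pow k (by omega)
    have he2 := Real.exp_one_lt_d9
    rw [rprod_succ]
    have e1 : (2 * ((k + 1 : ℕ) : ℝ) / 3) ^ (k + 1)
        = (2 * (k : ℝ) / 3) ^ k * ((1 + 1 / (k : ℝ)) ^ k * (2 * (k + 1) / 3)) := by
      rw [pow_succ, ← mul_assoc, ← mul_pow]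
      push_cast
      congr 2
      field_simp
    rw [e1]
    have h2 : (1 + 1 / (k : ℝ)) ^ k * (2 * (k + 1) / 3) ≤ 1 + 2 * k := by
      calc (1 + 1 / (k : ℝ)) ^ k * (2 * (k + 1) / 3) ≤ 2.7182818286 * (2 * (k + 1) / 3) := by
            gcongr; linarith
        _ ≤ 1 + 2 * k := by linarith
    exact mul_le_mul ih h2 (by positivity) (rprod_nonneg zero_le_one k)

lemma rprod_one_lower' (k : ℕ) (hk : 3 ≤ k) : (2 * (k : ℝ) / 3) ^ k ≤ rprod 1 k := by
  by_cases h5 : 5 ≤ k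
  · exact rprod_one_lower k h5
  · have : k = 3 ∨ k = 4 := by omega
    rcases this with rfl | rfl <;> norm_num [rprod, Finset.prod_range_succ]

lemma rprod_mul_le (a c : ℝ) (ha : 0 ≤ a) (hc : 0 ≤ c) (k : ℕ) :
    rprod a k * rprod c k ≤ (((a + c) / 2 + k) ^ 2) ^ k := by
  unfold rprod
  rw [← Finset.prod_range_reflect (fun j : ℕ => c + 2 * (j : ℝ)), ← Finset.prod_mul_distrib]
  calc _ ≤ ∏ _j ∈ Finset.range k, ((a + c) / 2 + (k : ℝ)) ^ 2 := by
        refine Finset.prod_le_prod (fun j _ => by positivity) (fun j hj => ?_)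
        have hj' := Finset.mem_range.1 hj
        have e : (((k - 1 - j : ℕ) : ℕ) : ℝ) = k - 1 - j := by
          rw [Nat.cast_sub (by omega), Nat.cast_sub (by omega)]; simp
        rw [e]
        have hk1 : (1 : ℝ) ≤ k := by exact_mod_cast (by omega : 1 ≤ k)
        nlinarith [sq_nonneg ((a + 2 * j) - (c + 2 * (k - 1 - j)))]
    _ = _ := by simp

lemma rprod_ge_pow (a c : ℝ) (ha : 0 ≤ a) (hac : a ≤ c) (k : ℕ) : a ^ k ≤ rprod c k := by
  unfold rprod
  calc a ^ k = ∏ _j ∈ Finset.range k, a := by simp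
    _ ≤ _ := Finset.prod_le_prod (fun _ _ => ha) (fun j _ => by
      have : (0 : ℝ) ≤ j := Nat.cast_nonneg j
      linarith)

/-- The purely numerical estimate. -/
lemma numeric_bound (m d n NC N y τ C : ℝ) (k : ℕ) (hk : 3 ≤ k) (hm : 0 ≤ m) (hd : 0 ≤ d)
    (hn : 0 < n) (hN : 0 < N) (hNC : 8 / 9 * N ≤ NC) (hτ : 0 ≤ τ) (hry : m + d + τ ≤ y)
    (hky : 2 * k ≤ y) (hyk : y ≤ 2 * k + 2) (hyn : y ≤ n) (hC : 9 * n * y / N ^ 2 ≤ C ^ 2) :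
    rprod m k * rprod d k * rprod n k / (C ^ (2 * k) * rprod 1 k * rprod NC k * rprod N k)
      ≤ 2 * Real.exp (-τ / 2) := by
  have hk3 : (3 : ℝ) ≤ k := by exact_mod_cast hk
  have hy : 0 < y := by linarith
  have hA := rprod_mul_le m d hm hd k
  have hB : rprod n k ≤ (3 / 2 * n) ^ k := by
    have h := rprod_mul_le n n hn.le hn.le k
    have h2 : rprod n k ≤ ((n + n) / 2 + k) ^ k := by
      rw [pow_right_comm, ← sq] at h
      exact (pow_le_pow_iff_left₀ (rprod_nonneg hn.le k) (by positivity) two_ne_zero).1 h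
    refine h2.trans (pow_le_pow_left₀ (by positivity) (by linarith) k)
  have hC1 := rprod_one_lower' k hk
  have hD1 := rprod_ge_pow (8 / 9 * N) NC (by positivity) hNC k
  have hD2 := rprod_ge_pow N N hN.le le_rfl k
  have hCp : (9 * n * y / N ^ 2) ^ k ≤ C ^ (2 * k) := by
    rw [pow_mul]; exact pow_le_pow_left₀ (by positivity) hC k
  have step1 : rprod m k * rprod d k * rprod n k /
      (C ^ (2 * k) * rprod 1 k * rprod NC k * rprod N k)
      ≤ (((m + d) / 2 + k) ^ 2) ^ k * (3 / 2 * n) ^ k /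
        ((9 * n * y / N ^ 2) ^ k * (2 * (k : ℝ) / 3) ^ k * (8 / 9 * N) ^ k * N ^ k) := by
    have := rprod_nonneg hn.le k
    have := rprod_nonneg zero_le_one k
    have h8 : 0 ≤ rprod NC k := rprod_nonneg (by nlinarith) k
    have hk0 : (0 : ℝ) < k := by linarith
    have := rprod_nonneg hm k
    have := rprod_nonneg hd k
    have hCC : 0 ≤ C ^ (2 * k) := by rw [pow_mul]; positivity
    have hCC1 : 0 ≤ C ^ (2 * k) * rprod 1 k := by positivity
    have hCC2 : 0 ≤ C ^ (2 * k) * rprod 1 k * rprod NC k := by positivity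
    gcongr
  refine step1.trans ?_
  have hk0 : (0 : ℝ) < k := by linarith
  have e2 : (((m + d) / 2 + k) ^ 2) ^ k * (3 / 2 * n) ^ k /
        ((9 * n * y / N ^ 2) ^ k * (2 * (k : ℝ) / 3) ^ k * (8 / 9 * N) ^ k * N ^ k)
      = (9 * ((m + d) / 2 + k) ^ 2 / (32 * k * y)) ^ k := by
    rw [← mul_pow, ← mul_pow, ← mul_pow, ← mul_pow, ← div_pow]
    congr 1
    field_simp
    ring
  rw [e2]
  have h3 : (m + d) / 2 + k ≤ y * Real.exp (-(τ / (2 * y))) := by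
    have h := Real.add_one_le_exp (-(τ / (2 * y)))
    have h' : y * (-(τ / (2 * y)) + 1) ≤ y * Real.exp (-(τ / (2 * y))) := by gcongr
    have e : y * (-(τ / (2 * y)) + 1) = y - τ / 2 := by field_simp; ring
    linarith
  have h4 : 9 * ((m + d) / 2 + k) ^ 2 / (32 * k * y)
      ≤ (9 / 16) * (1 + 1 / k) * Real.exp (-(τ / y)) := by
    calc 9 * ((m + d) / 2 + k) ^ 2 / (32 * k * y)
        ≤ 9 * (y * Real.exp (-(τ / (2 * y)))) ^ 2 / (32 * k * y) := by gcongr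
      _ = 9 * y / (32 * k) * Real.exp (-(τ / y)) := by
          rw [mul_pow, ← Real.exp_nat_mul]
          have : ((2 : ℕ) : ℝ) * -(τ / (2 * y)) = -(τ / y) := by push_cast; field_simp
          rw [this]; field_simp
      _ ≤ 9 * (2 * k + 2) / (32 * k) * Real.exp (-(τ / y)) := by gcongr
      _ = _ := by field_simp; ring
  calc (9 * ((m + d) / 2 + k) ^ 2 / (32 * k * y)) ^ k
      ≤ ((9 / 16) * (1 + 1 / k) * Real.exp (-(τ / y))) ^ k := by gcongr
    _ = (9 / 16) ^ k * (1 + 1 / (k : ℝ)) ^ k * Real.exp (k * -(τ / y)) := by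
        rw [mul_pow, mul_pow, Real.exp_nat_mul]
    _ ≤ (9 / 16) ^ 3 * Real.exp 1 * (Real.exp 1 * Real.exp (-τ / 2)) := by
        have q1 : (9 / 16 : ℝ) ^ k ≤ (9 / 16) ^ 3 :=
          pow_le_pow_of_le_one (by norm_num) (by norm_num) hk
        have q2 := one_add_inv_pow k (by omega)
        have q3 : Real.exp (k * -(τ / y)) ≤ Real.exp 1 * Real.exp (-τ / 2) := by
          rw [← Real.exp_add]
          apply Real.exp_le_exp.2
          have hty : τ / y ≤ 1 := (div_le_one hy).2 (by linarith)
          have hty0 : 0 ≤ τ / y := by positivity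
          have e : τ = τ / y * y := by field_simp
          have : τ / y * y ≤ τ / y * (2 * k + 2) := by gcongr
          linarith
        gcongr
    _ ≤ 2 * Real.exp (-τ / 2) := by
        have he := Real.exp_one_lt_d9
        have hp := Real.exp_pos 1
        have hq : (9 / 16 : ℝ) ^ 3 * Real.exp 1 * Real.exp 1 ≤ 2 := by nlinarith
        calc _ = (9 / 16 : ℝ) ^ 3 * Real.exp 1 * Real.exp 1 * Real.exp (-τ / 2) := by ring
          _ ≤ _ := by gcongr

lemma specNorm_smul_nonneg {m n : Type*} [Fintype m] [Fintype n] [DecidableEq n] (s : ℝ)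
    (hs : 0 ≤ s) (A : Matrix m n ℝ) : specNorm (s • A) = s * specNorm A := by
  unfold specNorm
  rw [map_smul, map_smul, norm_smul, Real.norm_of_nonneg hs]

lemma specNorm_zero' {m n : Type*} [Fintype m] [Fintype n] [DecidableEq n] :
    specNorm (0 : Matrix m n ℝ) = 0 := by
  unfold specNorm
  rw [map_zero, map_zero, norm_zero]

/-- Column selection matrix. -/
def selMat {ι τ : Type*} [DecidableEq ι] (f : τ → ι) : Matrix ι τ ℝ :=
  fun i t => if i = f t then 1 else 0

lemma mul_selMat {m ι τ : Type*} [Fintype ι] [DecidableEq ι] (f : τ → ι) (A : Matrix m ι ℝ) :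
    A * selMat f = fun i t => A i (f t) := by
  ext i t
  simp [Matrix.mul_apply, selMat]

lemma selMat_orth {ι τ : Type*} [Fintype ι] [DecidableEq ι] [DecidableEq τ] (f : τ → ι)
    (hf : Function.Injective f) : (selMat f)ᵀ * selMat f = 1 := by
  rw [mul_selMat]
  ext s t
  simp [selMat, Matrix.transpose_apply, Matrix.one_apply, hf.eq_iff, eq_comm]

lemma selMat_disj {ι τ σ : Type*} [Fintype ι] [DecidableEq ι] (f : τ → ι) (g : σ → ι)
    (h : ∀ t s, f t ≠ g s) : (selMat f)ᵀ * selMat g = 0 := by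
  rw [mul_selMat]
  ext s t
  simp [selMat, Matrix.transpose_apply, (h s t).symm]

set_option maxHeartbeats 2000000 in
lemma block_bound {Ω : Type*} [MeasurableSpace Ω] (P : Measure Ω) [IsProbabilityMeasure P]
    (n p d b : ℕ) (V : Ω → Matrix (Fin n) (Fin p × Fin d) ℝ)
    (hV : IsUniformStiefel P V)
    (B : Finset (Fin p)) (hB : B.card = b) (k₀ : Fin p) (hk₀ : k₀ ∉ B)
    (t : ℝ) (ht : 0 < t)
    (h₁ : Real.sqrt (((b + 1) * d : ℕ) / (n : ℝ)) + t < 1)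
    (h₃ : Real.sqrt (((b : ℝ) + 1) / p) < 1 / 3) (c : ℝ)
    (hc : 3 * (Real.sqrt (((b + 1) * d : ℕ) / (n : ℝ)) + t) ≤ c) :
    P {ω | c ≤ specNorm (((p * d : ℕ) / (n : ℝ)) • ((blockCols (V ω) B)ᵀ * colBlock (V ω) k₀))}
      ≤ ENNReal.ofReal (2 * Real.exp (-(n : ℝ) * t ^ 2 / 2)) := by
  have hc0 : 0 < c := by
    have := Real.sqrt_nonneg (((b + 1) * d : ℕ) / (n : ℝ))
    linarith
  by_cases hdeg : n = 0 ∨ b = 0 ∨ d = 0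
  · have hz : ∀ ω, (((p * d : ℕ) / (n : ℝ)) • ((blockCols (V ω) B)ᵀ * colBlock (V ω) k₀)) = 0 := by
      intro ω
      rcases hdeg with h | h | h
      · subst h; simp
      · ext i j
        exact absurd i.1.2 (by
          rw [h, Finset.card_eq_zero] at hB
          simp [hB])
      · subst h
        ext i j
        exact j.elim0
    have : {ω | c ≤ specNorm (((p * d : ℕ) / (n : ℝ)) •
        ((blockCols (V ω) B)ᵀ * colBlock (V ω) k₀))} = ∅ := by
      ext ω
      simp only [Set.mem_ofPred_eq, Set.mem_empty_iff_false, iff_false, not_le]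
      rw [hz, specNorm_zero']; exact hc0
    rw [this]; simp
  push Not at hdeg
  obtain ⟨hn0, hb0, hd0⟩ := hdeg
  by_cases htriv : 1 ≤ 2 * Real.exp (-(n : ℝ) * t ^ 2 / 2)
  · refine prob_le_one.trans ?_
    rw [← ENNReal.ofReal_one]
    exact ENNReal.ofReal_le_ofReal htriv
  push Not at htriv
  have hn : (0 : ℝ) < n := by exact_mod_cast Nat.pos_of_ne_zero hn0
  have hd : (1 : ℝ) ≤ d := by exact_mod_cast Nat.pos_of_ne_zero hd0
  have hb : (1 : ℝ) ≤ b := by exact_mod_cast Nat.pos_of_ne_zero hb0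
  have hp0 : 0 < p := k₀.pos
  have hp : (0 : ℝ) < p := by exact_mod_cast hp0
  have hbp : b ≤ p := by
    rw [← hB]; simpa using Finset.card_le_univ B
  have hbp9 : 9 * ((b : ℝ) + 1) ≤ p := by
    have h := (Real.sqrt_lt' (by norm_num)).1 h₃
    rw [div_lt_iff₀ hp] at h
    linarith
  set τ : ℝ := n * t ^ 2 with hτ
  have hτ0 : 0 < τ := by positivity
  have hτ1 : 1.38 < τ := by
    have hlog : Real.log (2 * Real.exp (-(n : ℝ) * t ^ 2 / 2)) < 0 :=
      Real.log_neg (by positivity) htriv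
    rw [Real.log_mul (by norm_num) (Real.exp_ne_zero _), Real.log_exp] at hlog
    have := Real.log_two_gt_d9
    have e : -(n : ℝ) * t ^ 2 / 2 = -τ / 2 := by rw [hτ]; ring
    rw [e] at hlog
    linarith
  set r : ℝ := (((b + 1) * d : ℕ) : ℝ) with hr
  have hr' : r = b * d + d := by rw [hr]; push_cast; ring
  have hr2 : 2 ≤ r := by nlinarith
  set x : ℝ := Real.sqrt (r / n) + t with hx
  set s : ℝ := Real.sqrt (r / n) with hs
  have hs0 : 0 ≤ s := Real.sqrt_nonneg _
  have hs2 : n * s ^ 2 = r := by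
    rw [hs, Real.sq_sqrt (by positivity)]; field_simp
  have hx0 : 0 < x := by linarith
  set y : ℝ := n * x ^ 2 with hy
  have hyn : y ≤ n := by
    rw [hy]
    have : x ^ 2 ≤ 1 := by nlinarith
    nlinarith
  have hye : y = r + τ + 2 * (n * s * t) := by
    rw [hy, hx, ← hs2, hτ]; ring
  have hu0 : 0 ≤ n * s * t := by positivity
  have hu2 : (n * s * t) ^ 2 = r * τ := by rw [← hs2, hτ]; ring
  have hu : 1.4 ≤ n * s * t := by
    by_contra hcon
    push Not at hcon
    have : (n * s * t) ^ 2 ≤ 1.4 ^ 2 := by gcongr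
    nlinarith
  have hy6 : 6 ≤ y := by linarith
  set k : ℕ := ⌊y / 2⌋₊ with hk
  have hk3 : 3 ≤ k := by
    rw [hk]; apply Nat.le_floor; push_cast; linarith
  have hky : 2 * (k : ℝ) ≤ y := by
    have := Nat.floor_le (a := y / 2) (by linarith)
    rw [← hk] at this
    linarith
  have hyk : y ≤ 2 * (k : ℝ) + 2 := by
    have := Nat.lt_floor_add_one (y / 2)
    rw [← hk] at this
    linarith
  set N : ℝ := ((p * d : ℕ) : ℝ) with hN
  have hN' : N = p * d := by rw [hN]; push_cast; ring
  have hN0 : 0 < N := by rw [hN']; positivity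
  set C : ℝ := c * n / N with hC
  have hC0 : 0 < C := by positivity
  have hCs : 9 * n * y / N ^ 2 ≤ C ^ 2 := by
    have e1 : 9 * n * y / N ^ 2 = (3 * x * n / N) ^ 2 := by rw [hy]; field_simp; ring
    rw [e1, hC]
    gcongr
  let F : Matrix (Fin p × Fin d) ({j // j ∈ B} × Fin d) ℝ := selMat (fun jk => (jk.1.1, jk.2))
  let G : Matrix (Fin p × Fin d) (Fin d) ℝ := selMat (fun l => (k₀, l))
  let E : Matrix (Fin p × Fin d) ({j // j ∈ Bᶜ} × Fin d) ℝ := selMat (fun jk => (jk.1.1, jk.2))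
  have hF : Fᵀ * F = 1 := selMat_orth _ (by
    rintro ⟨⟨a, ha⟩, l⟩ ⟨⟨a', ha'⟩, l'⟩ h; simpa using h)
  have hE : Eᵀ * E = 1 := selMat_orth _ (by
    rintro ⟨⟨a, ha⟩, l⟩ ⟨⟨a', ha'⟩, l'⟩ h; simpa using h)
  have hG : Gᵀ * G = 1 := selMat_orth _ (by intro l l' h; simpa using h)
  have hFG : Fᵀ * G = 0 := selMat_disj _ _ (by
    rintro ⟨⟨a, ha⟩, l⟩ l' h
    have : a = k₀ := (Prod.ext_iff.1 h).1
    exact hk₀ (this ▸ ha))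
  have hEF : Eᵀ * F = 0 := selMat_disj _ _ (by
    rintro ⟨⟨a, ha⟩, l⟩ ⟨⟨a', ha'⟩, l'⟩ h
    have : a = a' := (Prod.ext_iff.1 h).1
    exact (Finset.mem_compl.1 ha) (this ▸ ha'))
  have cτ : Fintype.card ({j // j ∈ B} × Fin d) = b * d := by
    rw [Fintype.card_prod, Fintype.card_coe, hB, Fintype.card_fin]
  have cσ : Fintype.card ({j // j ∈ Bᶜ} × Fin d) = (p - b) * d := by
    rw [Fintype.card_prod, Fintype.card_coe, Finset.card_compl, hB, Fintype.card_fin,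
      Fintype.card_fin]
  have cι : Fintype.card (Fin p × Fin d) = p * d := by simp
  have hNC : (((p - b) * d : ℕ) : ℝ) = (p - b) * d := by
    push_cast [Nat.cast_sub hbp]; ring
  have hNC9 : 8 / 9 * N ≤ (((p - b) * d : ℕ) : ℝ) := by
    rw [hNC, hN']; nlinarith
  have hNCpos : 0 < (p - b) * d := by
    have : (0 : ℝ) < (((p - b) * d : ℕ) : ℝ) := by linarith
    exact_mod_cast this
  have htail := tail_bound hV F G E hF hG hE hFG hEF k (by omega) C hC0
    (by rw [cσ]; exact hNCpos) (by rw [cι]; exact Nat.mul_pos hp0 (Nat.pos_of_ne_zero hd0))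
  have hset : {ω | c ≤ specNorm ((N / (n : ℝ)) • ((blockCols (V ω) B)ᵀ * colBlock (V ω) k₀))}
      = {ω | C ≤ specNorm ((V ω * F)ᵀ * (V ω * G))} := by
    ext ω
    have e1 : V ω * F = blockCols (V ω) B := by
      show V ω * selMat _ = _
      rw [mul_selMat]; rfl
    have e2 : V ω * G = colBlock (V ω) k₀ := by
      show V ω * selMat _ = _
      rw [mul_selMat]; rfl
    rw [Set.mem_ofPred_eq, Set.mem_ofPred_eq]
    rw [e1, e2, specNorm_smul_nonneg _ (by positivity), hC, div_le_iff₀ hN0, div_mul_eq_mul_div,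
      le_div_iff₀ hn, mul_comm N]
  rw [hset]
  refine htail.trans (ENNReal.ofReal_le_ofReal ?_)
  rw [cτ, cσ, cι, Fintype.card_fin]
  have hfin := numeric_bound ((b * d : ℕ) : ℝ) d n (((p - b) * d : ℕ) : ℝ) N y τ C k hk3
    (by positivity) (by positivity) hn hN0 hNC9 hτ0.le (by push_cast; linarith) hky hyk hyn hCs
  have e : -(n : ℝ) * t ^ 2 / 2 = -τ / 2 := by rw [hτ]; ring
  rw [e]
  exact hfin

/-- **Lemma S.6.** Uniform cross-Gram concentration between a block set `B` (`|B| = b`)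
and each of `q` blocks `k ∈ K` disjoint from `B`, for a uniform Stiefel matrix. -/
theorem stiefel_max_cross_gram_concentration'
    {Ω : Type*} [MeasurableSpace Ω] (P : Measure Ω) [IsProbabilityMeasure P]
    (n p d b q : ℕ) (V : Ω → Matrix (Fin n) (Fin p × Fin d) ℝ)
    (hV : IsUniformStiefel P V)
    (B K : Finset (Fin p)) (hB : B.card = b) (hK : K.card = q) (hBK : Disjoint B K)
    (hpbd : n ≤ (p - b - 1) * d)
    (t₁₄ t₁₅ t₁₆ : ℝ) (ht₁₄ : 0 < t₁₄) (ht₁₅ : 0 < t₁₅) (ht₁₆ : 0 < t₁₆)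
    (h₁ : Real.sqrt (((b + 1) * d : ℕ) / (n : ℝ)) + t₁₄ < 1)
    (h₂ : Real.sqrt (((b : ℝ) + 1) / p) + t₁₅ < 1)
    (h₃ : Real.sqrt (((b : ℝ) + 1) / p) + t₁₆ < 1 / 3) :
    P {ω | ∃ k ∈ K,
          (3 * (Real.sqrt (((b + 1) * d : ℕ) / (n : ℝ)) + t₁₄)
              + 3 * (Real.sqrt (((b : ℝ) + 1) / p) + t₁₅))
            / (1 - 3 * (Real.sqrt (((b : ℝ) + 1) / p) + t₁₆))
          ≤ specNorm (((p * d : ℕ) / (n : ℝ)) • ((blockCols (V ω) B)ᵀ * colBlock (V ω) k))}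
      ≤ (q : ℝ≥0∞) * ENNReal.ofReal (2 * Real.exp (-(n : ℝ) * t₁₄ ^ 2 / 2)
          + 2 * Real.exp (-((p * d : ℕ) : ℝ) * t₁₅ ^ 2 / 2)
          + Real.exp (-((p * d : ℕ) : ℝ) * t₁₆ ^ 2 / 2)) := by
  set x₁ := Real.sqrt (((b + 1) * d : ℕ) / (n : ℝ)) + t₁₄ with hx₁
  set z := Real.sqrt (((b : ℝ) + 1) / p) with hz
  have hz0 : 0 ≤ z := Real.sqrt_nonneg _
  have hx0 : 0 < x₁ := by
    have := Real.sqrt_nonneg (((b + 1) * d : ℕ) / (n : ℝ))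
    linarith
  set c := (3 * x₁ + 3 * (z + t₁₅)) / (1 - 3 * (z + t₁₆)) with hc
  have hcx : 3 * x₁ ≤ c := by
    rw [hc, le_div_iff₀ (by linarith)]
    nlinarith
  have hsub : {ω | ∃ k ∈ K, c ≤ specNorm (((p * d : ℕ) / (n : ℝ)) •
        ((blockCols (V ω) B)ᵀ * colBlock (V ω) k))}
      = ⋃ k ∈ K, {ω | c ≤ specNorm (((p * d : ℕ) / (n : ℝ)) •
        ((blockCols (V ω) B)ᵀ * colBlock (V ω) k))} := by
    ext ω; simp
  rw [hsub]
  refine (measure_biUnion_finset_le K _).trans ?_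
  rw [← hK, ← nsmul_eq_mul]
  refine Finset.sum_le_card_nsmul _ _ _ (fun k hk => ?_)
  refine (block_bound P n p d b V hV B hB k (fun h => Finset.disjoint_left.1 hBK h hk) t₁₄ ht₁₄ h₁
    (by linarith) c hcx).trans (ENNReal.ofReal_le_ofReal ?_)
  have := Real.exp_pos (-((p * d : ℕ) : ℝ) * t₁₅ ^ 2 / 2)
  have := Real.exp_pos (-((p * d : ℕ) : ℝ) * t₁₆ ^ 2 / 2)
  linarith
end
end

section
/- Let V be an n×(p·d) random real matrix uniformly distributed on the Stiefel manifold V(n, p·d), with columns partitioned into p consecutive blocks of d columns. Let B ⊆ {1,…,p} with |B| = b, K ⊆ {1,…,p} \ B with |K| = q, let s ≥ 1 be an integer, and let C > 0, λ̃ > 0. Suppose (p − b − 1)·d ≥ n, √((b+1)d/n) ≤ λ̃/(120 C √s), √((b+1)/p) ≤ min(λ̃/(120 C √s), 1/20), λ̃/(60 C √s) < 1, and λ̃/(120 C √s) ≤ 1/20. Then P[ max_{k∈K} ‖(p d/n)·V_Bᵀ V_k‖ ≥ λ̃/(7 C √s) ] ≤ 5 q·exp(−n λ̃²/(28800 C²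 s)). -/
open MeasureTheory ProbabilityTheory Filter Matrix
open scoped ENNReal NNReal

noncomputable section

/-- Standard Gaussian product measure. -/
def gam (ι : Type*) [Fintype ι] : Measure (ι → ℝ) := Measure.pi (fun _ : ι => gaussianReal 0 1)

instance (ι : Type*) [Fintype ι] : IsProbabilityMeasure (gam ι) := by
  unfold gam; infer_instance

lemma gauss_lower (a : ℝ) :
    ENNReal.ofReal (Real.exp a) ≤ ∫⁻ x, ENNReal.ofReal (Real.exp (a * x ^ 2)) ∂(gaussianReal 0 1) := by
  have hL : MemLp (fun x : ℝ => x) 2 (gaussianReal 0 1) := memLp_id_gaussianReal' 2 (by simp)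
  have hi : Integrable (fun x : ℝ => x ^ 2) (gaussianReal 0 1) := hL.integrable_sq
  have hv : ∫ x, x ^ 2 ∂(gaussianReal 0 1) = 1 := by
    have h := variance_fun_id_gaussianReal (μ := 0) (v := 1)
    rw [variance_of_integral_eq_zero (by fun_prop) (by simp)] at h
    simpa using h
  have hif : Integrable (fun x : ℝ => Real.exp a * (1 + a * (x ^ 2 - 1))) (gaussianReal 0 1) :=
    ((integrable_const 1).add ((hi.sub (integrable_const 1)).const_mul a)).const_mul _
  have hval : ∫ x, Real.exp a * (1 + a * (x ^ 2 - 1)) ∂(gaussianReal 0 1) = Real.exp a := by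
    have h1 : Integrable (fun x : ℝ => a * (x ^ 2 - 1)) (gaussianReal 0 1) :=
      (hi.sub (integrable_const 1)).const_mul a
    rw [integral_const_mul, integral_add (integrable_const 1) h1, integral_const_mul,
      integral_sub hi (integrable_const 1), hv]
    simp
  calc ENNReal.ofReal (Real.exp a)
      = ENNReal.ofReal (∫ x, Real.exp a * (1 + a * (x ^ 2 - 1)) ∂(gaussianReal 0 1)) := by rw [hval]
    _ ≤ ∫⁻ x, ENNReal.ofReal (Real.exp a * (1 + a * (x ^ 2 - 1))) ∂(gaussianReal 0 1) := by
        rw [integral_eq_lintegral_pos_part_sub_lintegral_neg_part hif]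
        refine (ENNReal.ofReal_le_ofReal (sub_le_self _ ENNReal.toReal_nonneg)).trans ?_
        exact ENNReal.ofReal_toReal_le
    _ ≤ _ := by
        refine lintegral_mono fun x => ENNReal.ofReal_le_ofReal ?_
        have : a * x ^ 2 = a + a * (x ^ 2 - 1) := by ring
        rw [this, Real.exp_add]
        have := Real.add_one_le_exp (a * (x ^ 2 - 1))
        gcongr
        linarith

lemma log_aux (a : ℝ) (ha : |a| ≤ 1 / 10) : -(a + 5 / 4 * a ^ 2) ≤ Real.log (1 - 2 * a) / 2 := by
  have hx : |2 * a| ≤ 1 / 5 := by rw [abs_mul]; norm_num; linarith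
  have h := Real.abs_log_sub_add_sum_range_le (x := 2 * a) (by linarith) 3
  have h1 := (abs_le.1 h).1
  simp only [Finset.sum_range_succ, Finset.sum_range_zero] at h1
  have h2 : |2 * a| ^ (3 + 1) / (1 - |2 * a|) ≤ (2 * a) ^ 2 * (1 / 20) := by
    rw [div_le_iff₀ (by linarith), ← sq_abs (2 * a)]
    have h0 := abs_nonneg (2 * a)
    have : |2 * a| ^ 2 ≤ (1 / 5) * (1 / 5) := by nlinarith
    nlinarith [sq_nonneg (|2 * a|)]
  have h3 : a ^ 3 ≤ a ^ 2 * (1 / 10) := by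
    have := (abs_le.1 ha).2
    nlinarith [sq_nonneg a]
  have h4 := (neg_le_neg h2).trans h1
  norm_num at h4
  nlinarith

lemma gauss_upper (a : ℝ) (ha : |a| ≤ 1 / 10) :
    ∫⁻ x, ENNReal.ofReal (Real.exp (a * x ^ 2)) ∂(gaussianReal 0 1)
      ≤ ENNReal.ofReal (Real.exp (a + 5 / 4 * a ^ 2)) := by
  have hb : 0 < 1 - 2 * a := by have := (abs_le.1 ha).2; linarith
  rw [gaussianReal_of_var_ne_zero _ one_ne_zero,
    lintegral_withDensity_eq_lintegral_mul _ (measurable_gaussianPDF _ _) (by fun_prop)]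
  have he : ∀ x : ℝ, (gaussianPDF 0 1 * fun x => ENNReal.ofReal (Real.exp (a * x ^ 2))) x
      = ENNReal.ofReal ((√(2 * Real.pi))⁻¹ * Real.exp (-((1 - 2 * a) / 2) * x ^ 2)) := by
    intro x
    simp only [Pi.mul_apply, gaussianPDF, gaussianPDFReal]
    rw [← ENNReal.ofReal_mul (by positivity), mul_assoc, ← Real.exp_add]
    congr 2
    · simp
    · congr 1; simp; ring
  simp_rw [he]
  rw [← ofReal_integral_eq_lintegral_ofReal
    ((integrable_exp_neg_mul_sq (by linarith)).const_mul _) (ae_of_all _ fun x => by positivity),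
    integral_const_mul, integral_gaussian]
  apply ENNReal.ofReal_le_ofReal
  have : (√(2 * Real.pi))⁻¹ * √(Real.pi / ((1 - 2 * a) / 2)) = (√(1 - 2 * a))⁻¹ := by
    rw [← Real.sqrt_inv, ← Real.sqrt_inv, ← Real.sqrt_mul (by positivity)]
    congr 1
    have := Real.pi_pos
    field_simp
  rw [this, ← Real.exp_log (Real.sqrt_pos.2 hb), ← Real.exp_neg, Real.log_sqrt hb.le]
  apply Real.exp_le_exp.2
  linarith [log_aux a ha]

lemma gam_exp {ι : Type*} [Fintype ι] (a : ℝ) :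
    ∫⁻ g, ENNReal.ofReal (Real.exp (a * (g ⬝ᵥ g))) ∂(gam ι)
      = (∫⁻ x, ENNReal.ofReal (Real.exp (a * x ^ 2)) ∂(gaussianReal 0 1)) ^ (Fintype.card ι) := by
  have h := lintegral_prod_eq_prod_lintegral_of_indepFun (μ := gam ι) Finset.univ
    (fun i (g : ι → ℝ) => ENNReal.ofReal (Real.exp (a * (g i) ^ 2)))
    (iIndepFun_pi (X := fun _ (x : ℝ) => ENNReal.ofReal (Real.exp (a * x ^ 2)))
      (fun i => by fun_prop)) (fun i => by fun_prop)
  have h2 : ∀ i : ι, ∫⁻ g, ENNReal.ofReal (Real.exp (a * (g i) ^ 2)) ∂(gam ι)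
      = ∫⁻ x, ENNReal.ofReal (Real.exp (a * x ^ 2)) ∂(gaussianReal 0 1) := by
    intro i
    exact (measurePreserving_eval (fun _ : ι => gaussianReal 0 1) i).lintegral_comp
      (f := fun x => ENNReal.ofReal (Real.exp (a * x ^ 2))) (by fun_prop)
  simp_rw [h2] at h
  rw [Finset.prod_const, Finset.card_univ] at h
  rw [← h]
  refine lintegral_congr fun g => ?_
  rw [← ENNReal.ofReal_prod_of_nonneg (fun i _ => (Real.exp_pos _).le), ← Real.exp_sum,
    ← Finset.mul_sum]
  simp [dotProduct, sq]

lemma gam_map {ι κ : Type*} [Fintype ι] [Fintype κ] [DecidableEq ι] [DecidableEq κ]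
    (V : Matrix κ ι ℝ) (hV : V * Vᵀ = 1) :
    (gam ι).map (fun g => V *ᵥ g) = gam κ := by
  have hm : Measurable (fun g : ι → ℝ => V *ᵥ g) :=
    (V.mulVecLin.continuous_of_finiteDimensional).measurable
  suffices h : ((gam ι).map (fun g => V *ᵥ g)).map (WithLp.toLp 2) = (gam κ).map (WithLp.toLp 2) by
    have h2 := congrArg (Measure.map (WithLp.ofLp)) h
    rw [Measure.map_map (by fun_prop) (by fun_prop),
      Measure.map_map (μ := gam κ) (by fun_prop) (by fun_prop)] at h2
    have hid : (WithLp.ofLp ∘ WithLp.toLp 2 : (κ → ℝ) → (κ → ℝ)) = id := rfl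
    rwa [hid, Measure.map_id, Measure.map_id] at h2
  apply Measure.ext_of_charFun (E := EuclideanSpace ℝ κ)
  ext t
  rw [gam, gam, map_pi_eq_stdGaussian, charFun_stdGaussian]
  have : charFun (Measure.map (WithLp.toLp 2)
      (Measure.map (fun g => V *ᵥ g) (Measure.pi fun _ : ι => gaussianReal 0 1))) t
      = charFun (stdGaussian (EuclideanSpace ℝ ι)) (WithLp.toLp 2 (Vᵀ *ᵥ t.ofLp)) := by
    rw [← map_pi_eq_stdGaussian, charFun_apply, charFun_apply, integral_map (by fun_prop) (by fun_prop),
      integral_map (by fun_prop) (by fun_prop), integral_map (by fun_prop) (by fun_prop)]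
    congr 1
    ext g
    congr 3
    simp only [EuclideanSpace.inner_eq_star_dotProduct, star_trivial]
    rw [dotProduct_mulVec, Matrix.mulVec_transpose]
  rw [this, charFun_stdGaussian]
  have h3 : ‖(WithLp.toLp 2 (Vᵀ *ᵥ t.ofLp) : EuclideanSpace ℝ ι)‖ ^ 2 = ‖t‖ ^ 2 := by
    rw [← real_inner_self_eq_norm_sq, ← real_inner_self_eq_norm_sq]
    simp only [EuclideanSpace.inner_eq_star_dotProduct, star_trivial]
    rw [dotProduct_mulVec, Matrix.vecMul_transpose, Matrix.mulVec_mulVec, hV, Matrix.one_mulVec]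
  have h4 := congrArg (fun r : ℝ => (r : ℂ)) h3
  push_cast at h4
  rw [h4]

lemma exists_orth {ι : Type*} [Fintype ι] [DecidableEq ι] (w g : ι → ℝ) (h : w ⬝ᵥ w = g ⬝ᵥ g) :
    ∃ O : Matrix ι ι ℝ, O * Oᵀ = 1 ∧ O *ᵥ w = g := by
  by_cases hu : w - g = 0
  · exact ⟨1, by simp, by simp [sub_eq_zero.1 hu]⟩
  set u := w - g with hud
  have huu : u ⬝ᵥ u ≠ 0 := fun h0 => hu (dotProduct_self_eq_zero.1 h0)
  have h2 : u ⬝ᵥ u = 2 * (u ⬝ᵥ w) := by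
    simp only [hud, sub_dotProduct, dotProduct_sub]
    rw [h, dotProduct_comm w g]; ring
  refine ⟨1 - (2 / (u ⬝ᵥ u)) • vecMulVec u u, ?_, ?_⟩
  · have ht : (vecMulVec u u)ᵀ = vecMulVec u u := by rw [transpose_vecMulVec]
    have hm : vecMulVec u u * vecMulVec u u = (u ⬝ᵥ u) • vecMulVec u u := by
      rw [vecMulVec_mul_vecMulVec]; ext i j; simp [vecMulVec_apply]; ring
    rw [transpose_sub, transpose_smul, ht, transpose_one, sub_mul, mul_sub, mul_sub,
      smul_mul_smul_comm, hm, smul_smul]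
    simp only [mul_one, one_mul]
    have : 2 / u ⬝ᵥ u * (2 / u ⬝ᵥ u) * u ⬝ᵥ u = 2 * (2 / u ⬝ᵥ u) := by field_simp
    rw [this, mul_smul, two_smul]; abel
  · rw [sub_mulVec, one_mulVec, smul_mulVec, vecMulVec_mulVec]
    have : (2 / u ⬝ᵥ u) • (MulOpposite.op (u ⬝ᵥ w)) • u = u := by
      ext i; simp only [Pi.smul_apply, MulOpposite.smul_eq_mul_unop, MulOpposite.unop_op, smul_eq_mul]
      rw [h2]; rw [h2] at huu
      have : u ⬝ᵥ w ≠ 0 := fun h0 => huu (by simp [h0])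
      field_simp
    rw [this, hud]; simp

lemma meas_entry_s13 {Ω ι κ : Type*} [MeasurableSpace Ω] {V : Ω → Matrix κ ι ℝ} (hV : Measurable V)
    (i : κ) (j : ι) : Measurable (fun ω => V ω i j) := by
  have h1 : Measurable (fun ω => (V ω : κ → ι → ℝ)) := hV
  exact (measurable_pi_iff.1 ((measurable_pi_iff.1 h1) i)) j

lemma meas_quad {Ω ι κ : Type*} [MeasurableSpace Ω] [Fintype ι] [Fintype κ]
    {V : Ω → Matrix κ ι ℝ} (hV : Measurable V) {g : Ω → ι → ℝ} (hg : Measurable g) :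
    Measurable (fun ω => (V ω *ᵥ g ω) ⬝ᵥ (V ω *ᵥ g ω)) := by
  have h := fun i j => meas_entry_s13 hV i j
  have h2 := measurable_pi_iff.1 hg
  simp only [mulVec, dotProduct]
  fun_prop

lemma mgf_bound {Ω ι : Type*} [MeasurableSpace Ω] [Fintype ι] [DecidableEq ι]
    (P : Measure Ω) [IsProbabilityMeasure P] {n : ℕ} (V : Ω → Matrix (Fin n) ι ℝ)
    (hV : IsUniformStiefel P V) (w : ι → ℝ) (hw : w ⬝ᵥ w = 2) (θ : ℝ) (hθ : |θ| ≤ 1 / 10) :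
    ∫⁻ ω, ENNReal.ofReal (Real.exp (θ * (Fintype.card ι) * ((V ω *ᵥ w) ⬝ᵥ (V ω *ᵥ w)) / 2)) ∂P
      ≤ ENNReal.ofReal (Real.exp (n * (θ + 5 / 4 * θ ^ 2))) := by
  obtain ⟨hm, hI, hO⟩ := hV
  have hinv : ∀ g : ι → ℝ, ∫⁻ ω, ENNReal.ofReal (Real.exp (θ * ((V ω *ᵥ g) ⬝ᵥ (V ω *ᵥ g)))) ∂P
      = ∫⁻ ω, ENNReal.ofReal
        (Real.exp (θ * ((V ω *ᵥ w) ⬝ᵥ (V ω *ᵥ w)) / 2 * (g ⬝ᵥ g))) ∂P := by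
    intro g
    have hgg : 0 ≤ g ⬝ᵥ g := Finset.sum_nonneg fun i _ => mul_self_nonneg (g i)
    set c := √(g ⬝ᵥ g / 2) with hc
    have hc2 : c * c = g ⬝ᵥ g / 2 := Real.mul_self_sqrt (by positivity)
    obtain ⟨O, hOO, hOw⟩ := exists_orth (c • w) g (by
      rw [smul_dotProduct, dotProduct_smul, hw, smul_eq_mul, smul_eq_mul, ← mul_assoc, hc2]; ring)
    set F : Matrix (Fin n) ι ℝ → ℝ≥0∞ := fun M => ENNReal.ofReal
        (Real.exp (θ * ((M *ᵥ w) ⬝ᵥ (M *ᵥ w)) / 2 * (g ⬝ᵥ g))) with hF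
    have hFm : Measurable F := by
      have := meas_quad (V := fun M : Matrix (Fin n) ι ℝ => M) measurable_id
        (g := fun _ => w) measurable_const
      rw [hF]; fun_prop
    have hVO : Measurable (fun ω => V ω * O) := by
      have h := fun i j => meas_entry_s13 hm i j
      have : Measurable (fun ω i j => (V ω * O) i j) := by
        simp only [Matrix.mul_apply]
        fun_prop
      exact this
    have h1 : ∫⁻ ω, F (V ω * O) ∂P = ∫⁻ ω, F (V ω) ∂P := by
      rw [← lintegral_map hFm hVO, hO O hOO, lintegral_map hFm hm]
    rw [← h1]
    refine lintegral_congr fun ω => ?_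
    rw [hF]
    simp only
    rw [← hOw]
    simp only [mulVec_smul, dotProduct_smul, smul_dotProduct, smul_eq_mul, mulVec_mulVec]
    congr 2
    have h3 : (O *ᵥ w) ⬝ᵥ (O *ᵥ w) = 2 := by
      rw [dotProduct_mulVec, ← mulVec_transpose, mulVec_mulVec, mul_eq_one_comm.1 hOO, one_mulVec, hw]
    rw [h3]; ring
  have hjm : Measurable (fun z : Ω × (ι → ℝ) => (V z.1 *ᵥ z.2) ⬝ᵥ (V z.1 *ᵥ z.2)) :=
    meas_quad (hm.comp measurable_fst) measurable_snd
  have hqm : Measurable (fun ω => (V ω *ᵥ w) ⬝ᵥ (V ω *ᵥ w)) := meas_quad hm measurable_const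
  have hdm : Measurable (fun g : ι → ℝ => g ⬝ᵥ g) := by simp only [dotProduct]; fun_prop
  calc ∫⁻ ω, ENNReal.ofReal (Real.exp (θ * (Fintype.card ι) * ((V ω *ᵥ w) ⬝ᵥ (V ω *ᵥ w)) / 2)) ∂P
      ≤ ∫⁻ ω, ∫⁻ g, ENNReal.ofReal
        (Real.exp (θ * ((V ω *ᵥ w) ⬝ᵥ (V ω *ᵥ w)) / 2 * (g ⬝ᵥ g))) ∂(gam ι) ∂P := by
        refine lintegral_mono fun ω => ?_
        simp only
        rw [gam_exp]
        refine le_trans (le_of_eq ?_) (pow_le_pow_left₀ zero_le (gauss_lower _) _)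
        rw [← ENNReal.ofReal_pow (Real.exp_pos _).le, ← Real.exp_nat_mul]
        congr 2; ring
    _ = ∫⁻ g, ∫⁻ ω, ENNReal.ofReal
        (Real.exp (θ * ((V ω *ᵥ w) ⬝ᵥ (V ω *ᵥ w)) / 2 * (g ⬝ᵥ g))) ∂P ∂(gam ι) := by
        refine lintegral_lintegral_swap (Measurable.aemeasurable ?_)
        have h1 : Measurable (fun z : Ω × (ι → ℝ) => (V z.1 *ᵥ w) ⬝ᵥ (V z.1 *ᵥ w)) :=
          hqm.comp measurable_fst
        have h2 : Measurable (fun z : Ω × (ι → ℝ) => z.2 ⬝ᵥ z.2) := hdm.comp measurable_snd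
        simp only [Function.uncurry_def]
        fun_prop
    _ = ∫⁻ g, ∫⁻ ω, ENNReal.ofReal (Real.exp (θ * ((V ω *ᵥ g) ⬝ᵥ (V ω *ᵥ g)))) ∂P ∂(gam ι) := by
        simp_rw [hinv]
    _ = ∫⁻ ω, ∫⁻ g, ENNReal.ofReal (Real.exp (θ * ((V ω *ᵥ g) ⬝ᵥ (V ω *ᵥ g)))) ∂(gam ι) ∂P := by
        refine lintegral_lintegral_swap (Measurable.aemeasurable ?_)
        have h1 : Measurable (fun z : (ι → ℝ) × Ω => (V z.2 *ᵥ z.1) ⬝ᵥ (V z.2 *ᵥ z.1)) :=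
          hjm.comp measurable_swap
        simp only [Function.uncurry_def]
        fun_prop
    _ ≤ ∫⁻ ω, ENNReal.ofReal (Real.exp (n * (θ + 5 / 4 * θ ^ 2))) ∂P := by
        refine lintegral_mono_ae ?_
        filter_upwards [hI] with ω hω
        have hmv : Measurable (fun g : ι → ℝ => V ω *ᵥ g) :=
          ((V ω).mulVecLin.continuous_of_finiteDimensional).measurable
        have hdm' : Measurable (fun g : Fin n → ℝ => g ⬝ᵥ g) := by simp only [dotProduct]; fun_prop
        rw [← lintegral_map (μ := gam ι) (g := fun g : ι → ℝ => V ω *ᵥ g)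
          (f := fun h => ENNReal.ofReal (Real.exp (θ * (h ⬝ᵥ h)))) (by fun_prop) hmv,
          gam_map _ hω, gam_exp, Fintype.card_fin]
        refine (pow_le_pow_left₀ zero_le (gauss_upper _ hθ) _).trans (le_of_eq ?_)
        rw [← ENNReal.ofReal_pow (Real.exp_pos _).le, ← Real.exp_nat_mul]
    _ = _ := by simp

lemma pair_tail {Ω ι : Type*} [MeasurableSpace Ω] [Fintype ι] [DecidableEq ι]
    (P : Measure Ω) [IsProbabilityMeasure P] {n : ℕ} (V : Ω → Matrix (Fin n) ι ℝ)
    (hV : IsUniformStiefel P V) (x y : ι → ℝ) (hx : x ⬝ᵥ x = 1) (hy : y ⬝ᵥ y = 1)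
    (hxy : x ⬝ᵥ y = 0) (ε : ℝ) (hε : 0 ≤ ε) (hε' : ε ≤ 1 / 20) :
    P {ω | 4 * ε * n ≤ (Fintype.card ι) * ((V ω *ᵥ x) ⬝ᵥ (V ω *ᵥ y))}
      ≤ ENNReal.ofReal (Real.exp (-3 * n * ε ^ 2)) := by
  have hyx : y ⬝ᵥ x = 0 := by rw [dotProduct_comm, hxy]
  have hθ : |2 * ε| ≤ 1 / 10 := by rw [abs_of_nonneg (by linarith)]; linarith
  have hA := mgf_bound P V hV (x + y)
    (by simp only [add_dotProduct, dotProduct_add, hx, hy, hxy, hyx]; norm_num) (2 * ε) hθ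
  have hB := mgf_bound P V hV (x - y)
    (by simp only [sub_dotProduct, dotProduct_sub, hx, hy, hxy, hyx]; norm_num) (-(2 * ε))
    (by rwa [abs_neg])
  have hAm : Measurable (fun ω => (V ω *ᵥ (x + y)) ⬝ᵥ (V ω *ᵥ (x + y))) :=
    meas_quad hV.1 measurable_const
  have hBm : Measurable (fun ω => (V ω *ᵥ (x - y)) ⬝ᵥ (V ω *ᵥ (x - y))) :=
    meas_quad hV.1 measurable_const
  set N : ℝ := (Fintype.card ι : ℝ)
  set A : Ω → ℝ := fun ω => 2 * ε * N * ((V ω *ᵥ (x + y)) ⬝ᵥ (V ω *ᵥ (x + y))) / 2 with hAd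
  set B : Ω → ℝ := fun ω => -(2 * ε) * N * ((V ω *ᵥ (x - y)) ⬝ᵥ (V ω *ᵥ (x - y))) / 2 with hBd
  set cA : ℝ := Real.exp (-(2 * ε * n) - 8 * ε ^ 2 * n) / 2
  set cB : ℝ := Real.exp (2 * ε * n - 8 * ε ^ 2 * n) / 2
  have hcA : 0 ≤ cA := by positivity
  have hcB : 0 ≤ cB := by positivity
  have hkey : ∀ ω ∈ {ω | 4 * ε * n ≤ N * ((V ω *ᵥ x) ⬝ᵥ (V ω *ᵥ y))},
      1 ≤ cA * Real.exp (A ω) + cB * Real.exp (B ω) := by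
    intro ω hω
    simp only [Set.mem_ofPred_eq] at hω
    have hpol : A ω + B ω = 4 * ε * (N * ((V ω *ᵥ x) ⬝ᵥ (V ω *ᵥ y))) := by
      simp only [hAd, hBd, mulVec_add, mulVec_sub, add_dotProduct, dotProduct_add, sub_dotProduct,
        dotProduct_sub]
      rw [dotProduct_comm (V ω *ᵥ y) (V ω *ᵥ x)]; ring
    have h1 : 0 ≤ (-(2 * ε * n) - 8 * ε ^ 2 * n + A ω) + (2 * ε * n - 8 * ε ^ 2 * n + B ω) := by
      have := mul_le_mul_of_nonneg_left hω (show 0 ≤ 4 * ε by linarith)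
      nlinarith
    have h2 : cA * Real.exp (A ω) = Real.exp (-(2 * ε * n) - 8 * ε ^ 2 * n + A ω) / 2 := by
      rw [Real.exp_add]; ring
    have h3 : cB * Real.exp (B ω) = Real.exp (2 * ε * n - 8 * ε ^ 2 * n + B ω) / 2 := by
      rw [Real.exp_add]; ring
    rw [h2, h3]
    have := Real.add_one_le_exp (-(2 * ε * n) - 8 * ε ^ 2 * n + A ω)
    have := Real.add_one_le_exp (2 * ε * n - 8 * ε ^ 2 * n + B ω)
    linarith
  have hAe : Measurable (fun ω => ENNReal.ofReal (Real.exp (A ω))) := by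
    simp only [hAd]; fun_prop
  have hBe : Measurable (fun ω => ENNReal.ofReal (Real.exp (B ω))) := by
    simp only [hBd]; fun_prop
  calc P {ω | 4 * ε * n ≤ N * ((V ω *ᵥ x) ⬝ᵥ (V ω *ᵥ y))}
      ≤ P {ω | 1 ≤ ENNReal.ofReal cA * ENNReal.ofReal (Real.exp (A ω))
          + ENNReal.ofReal cB * ENNReal.ofReal (Real.exp (B ω))} := by
        refine measure_mono fun ω hω => ?_
        simp only [Set.mem_ofPred_eq]
        rw [← ENNReal.ofReal_mul hcA, ← ENNReal.ofReal_mul hcB,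
          ← ENNReal.ofReal_add (by positivity) (by positivity)]
        exact ENNReal.one_le_ofReal.2 (hkey ω hω)
    _ ≤ ∫⁻ ω, ENNReal.ofReal cA * ENNReal.ofReal (Real.exp (A ω))
          + ENNReal.ofReal cB * ENNReal.ofReal (Real.exp (B ω)) ∂P := by
        have := mul_meas_ge_le_lintegral₀ (μ := P) (f := fun ω =>
          ENNReal.ofReal cA * ENNReal.ofReal (Real.exp (A ω))
          + ENNReal.ofReal cB * ENNReal.ofReal (Real.exp (B ω)))
          ((hAe.const_mul _).add (hBe.const_mul _)).aemeasurable 1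
        rwa [one_mul] at this
    _ ≤ ENNReal.ofReal cA * ENNReal.ofReal (Real.exp (n * (2 * ε + 5 / 4 * (2 * ε) ^ 2)))
        + ENNReal.ofReal cB * ENNReal.ofReal
          (Real.exp (n * (-(2 * ε) + 5 / 4 * (-(2 * ε)) ^ 2))) := by
        rw [lintegral_add_left (hAe.const_mul _), lintegral_const_mul _ hAe,
          lintegral_const_mul _ hBe]
        gcongr
    _ = _ := by
        rw [← ENNReal.ofReal_mul hcA, ← ENNReal.ofReal_mul hcB,
          ← ENNReal.ofReal_add (by positivity) (by positivity)]
        congr 1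
        simp only [cA, cB]
        rw [div_mul_eq_mul_div (Real.exp _), div_mul_eq_mul_div (Real.exp (2 * ε * n - 8 * ε ^ 2 * n)),
          ← Real.exp_add, ← Real.exp_add]
        have e1 : -(2 * ε * n) - 8 * ε ^ 2 * n + n * (2 * ε + 5 / 4 * (2 * ε) ^ 2)
          = -3 * n * ε ^ 2 := by ring
        have e2 : 2 * ε * n - 8 * ε ^ 2 * n + n * (-(2 * ε) + 5 / 4 * (-(2 * ε)) ^ 2)
          = -3 * n * ε ^ 2 := by ring
        rw [e1, e2]; ring

lemma exists_net (E : Type*) [NormedAddCommGroup E] [NormedSpace ℝ E] [FiniteDimensional ℝ E] :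
    ∃ S : Finset E, S.card ≤ 5 ^ (Module.finrank ℝ E) ∧ (∀ s ∈ S, ‖s‖ = 1) ∧
      ∀ x : E, ‖x‖ = 1 → ∃ s ∈ S, ‖x - s‖ ≤ 1 / 2 := by
  classical
  let good : Finset E → Prop := fun S => (∀ s ∈ S, ‖s‖ = 1) ∧
    ∀ c ∈ S, ∀ d ∈ S, c ≠ d → 1 / 2 ≤ ‖c - d‖
  have hbound : ∀ S, good S → S.card ≤ 5 ^ (Module.finrank ℝ E) := by
    intro S hS
    have hinj : Function.Injective (fun x : E => (2 : ℝ) • x) := smul_right_injective E two_ne_zero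
    have := Besicovitch.card_le_of_separated (S.image (fun x : E => (2 : ℝ) • x)) (by
      intro c hc
      obtain ⟨s, hs, rfl⟩ := Finset.mem_image.1 hc
      simp [norm_smul, hS.1 s hs]) (by
      intro c hc d hd hcd
      obtain ⟨s, hs, rfl⟩ := Finset.mem_image.1 hc
      obtain ⟨t, ht, rfl⟩ := Finset.mem_image.1 hd
      have hst : s ≠ t := fun h => hcd (by rw [h])
      have := hS.2 s hs t ht hst
      rw [← smul_sub, norm_smul]
      norm_num
      linarith)
    rwa [Finset.card_image_of_injective _ hinj] at this
  have hex : ∃ m, ∃ S, good S ∧ S.card = m := ⟨0, ∅, by simp [good], rfl⟩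
  let m := Nat.findGreatest (fun m => ∃ S, good S ∧ S.card = m) (5 ^ (Module.finrank ℝ E))
  obtain ⟨S, hS, hSm⟩ : ∃ S, good S ∧ S.card = m :=
    Nat.findGreatest_spec (P := fun m => ∃ S, good S ∧ S.card = m) (m := 0) (Nat.zero_le _)
      ⟨∅, by simp [good], rfl⟩
  refine ⟨S, hbound S hS, hS.1, fun x hx => ?_⟩
  by_contra! hcon
  have hxS : x ∉ S := fun h => by have := hcon x h; simp at this; linarith
  have hg : good (insert x S) := by
    refine ⟨?_, ?_⟩
    · intro s hs
      rcases Finset.mem_insert.1 hs with rfl | hs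
      · exact hx
      · exact hS.1 s hs
    · intro c hc d hd hcd
      rcases Finset.mem_insert.1 hc with hc1 | hc1 <;>
        rcases Finset.mem_insert.1 hd with hd1 | hd1
      · exact absurd (hc1.trans hd1.symm) hcd
      · rw [hc1]; exact (hcon d hd1).le
      · rw [hd1, norm_sub_rev]; exact (hcon c hc1).le
      · exact hS.2 c hc1 d hd1 hcd
  have := Nat.le_findGreatest (P := fun m => ∃ S, good S ∧ S.card = m) (hbound _ hg) ⟨_, hg, rfl⟩
  rw [Finset.card_insert_of_notMem hxS, hSm] at this
  exact absurd this (by simp [m])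

lemma norm_le_of_net {E F : Type*} [NormedAddCommGroup E] [InnerProductSpace ℝ E]
    [NormedAddCommGroup F] [InnerProductSpace ℝ F] (T : E →L[ℝ] F) (S : Set E) (R : Set F)
    (hS : ∀ x : E, ‖x‖ = 1 → ∃ s ∈ S, ‖x - s‖ ≤ 1 / 2)
    (hR : ∀ x : F, ‖x‖ = 1 → ∃ s ∈ R, ‖x - s‖ ≤ 1 / 2) (c : ℝ) (hc : 0 ≤ c)
    (h : ∀ s ∈ S, ∀ r ∈ R, inner ℝ r (T s) ≤ c) : ‖T‖ ≤ 4 * c := by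
  have h1 : ∀ s ∈ S, ‖T s‖ ≤ 2 * c := by
    intro s hs
    by_cases h0 : T s = 0
    · rw [h0, norm_zero]; positivity
    have hpos : 0 < ‖T s‖ := norm_pos_iff.2 h0
    obtain ⟨r, hr, hd⟩ := hR ((‖T s‖)⁻¹ • T s) (by rw [norm_smul, norm_inv, norm_norm]; field_simp)
    have h2 := h s hs r hr
    have h3 := real_inner_le_norm ((‖T s‖)⁻¹ • T s - r) (T s)
    rw [inner_sub_left, real_inner_smul_left, real_inner_self_eq_norm_sq] at h3
    have h4 : ‖T s‖⁻¹ * ‖T s‖ ^ 2 = ‖T s‖ := by field_simp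
    have := mul_le_mul_of_nonneg_right hd hpos.le
    linarith
  have h2 : ‖T‖ ≤ 2 * c + ‖T‖ / 2 := by
    refine T.opNorm_le_of_unit_norm (by positivity) ?_
    intro x hx
    obtain ⟨s, hs, hd⟩ := hS x hx
    have h3 : T x = T s + T (x - s) := by rw [map_sub]; abel
    rw [h3]
    refine (norm_add_le _ _).trans (add_le_add (h1 s hs) ((T.le_opNorm _).trans ?_))
    have := mul_le_mul_of_nonneg_left hd (norm_nonneg T)
    linarith
  linarith

/-- **Lemma S.6, specialized.** With `t₁₄ = λ̃/(60C√s) − √((b+1)d/n)`,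
`t₁₅ = λ̃/(60C√s) − √((b+1)/p)`, `t₁₆ = 1/10 − √((b+1)/p)`:
`P[max_{k∈K} ‖(pd/n)·V_Bᵀ V_k‖ ≥ λ̃/(7C√s)] ≤ 5q exp(−n λ̃²/(28800 C² s))`. -/
theorem stiefel_max_cross_gram_concentration'_specialized
    {Ω : Type*} [MeasurableSpace Ω] (P : Measure Ω) [IsProbabilityMeasure P]
    (n p d b q s : ℕ) (hs : 1 ≤ s) (V : Ω → Matrix (Fin n) (Fin p × Fin d) ℝ)
    (hV : IsUniformStiefel P V)
    (B K : Finset (Fin p)) (hB : B.card = b) (hK : K.card = q) (hBK : Disjoint B K)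
    (C lam : ℝ) (hC : 0 < C) (hlam : 0 < lam)
    (hpbd : n ≤ (p - b - 1) * d)
    (h₁ : Real.sqrt (((b + 1) * d : ℕ) / (n : ℝ)) ≤ lam / (120 * C * Real.sqrt s))
    (h₂ : Real.sqrt (((b : ℝ) + 1) / p) ≤ min (lam / (120 * C * Real.sqrt s)) (1 / 20))
    (h₃ : lam / (60 * C * Real.sqrt s) < 1)
    (h₄ : lam / (120 * C * Real.sqrt s) ≤ 1 / 20) :
    P {ω | ∃ k ∈ K,
          lam / (7 * C * Real.sqrt s)
          ≤ specNorm (((p * d : ℕ) / (n : ℝ)) • ((blockCols (V ω) B)ᵀ * colBlock (V ω) k))}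
      ≤ (q : ℝ≥0∞) * ENNReal.ofReal (5 * Real.exp (-(n : ℝ) * lam ^ 2 / (28800 * C ^ 2 * s))) := by
  classical
  rcases Nat.eq_zero_or_pos n with hn | hn
  · have hempty : {ω | ∃ k ∈ K, lam / (7 * C * Real.sqrt s)
          ≤ specNorm (((p * d : ℕ) / (n : ℝ)) • ((blockCols (V ω) B)ᵀ * colBlock (V ω) k))} = ∅ := by
      ext ω
      simp only [Set.mem_ofPred_eq, Set.mem_empty_iff_false, iff_false]
      rintro ⟨k, -, hk⟩
      have h0 : ((n : ℕ) : ℝ) = 0 := by rw [hn]; simp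
      rw [h0, div_zero, zero_smul] at hk
      have h1 : 0 < lam / (7 * C * Real.sqrt s) := by
        have : (0 : ℝ) < s := by exact_mod_cast hs
        positivity
      simp [specNorm] at hk
      linarith
    rw [hempty, measure_empty]
    exact zero_le
  have hs0 : (0 : ℝ) < s := by exact_mod_cast hs
  have hsq : 0 < Real.sqrt s := Real.sqrt_pos.2 hs0
  have hn0 : (0 : ℝ) < n := by exact_mod_cast hn
  set ε : ℝ := lam / (120 * C * Real.sqrt s) with hεd
  have hε : 0 < ε := by positivity
  have hthr : lam / (7 * C * Real.sqrt s) = 120 / 7 * ε := by rw [hεd]; field_simp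
  have hexp : -(n : ℝ) * lam ^ 2 / (28800 * C ^ 2 * s) = -(n * ε ^ 2 / 2) := by
    rw [hεd, div_pow, mul_pow, Real.sq_sqrt hs0.le]
    field_simp
    ring
  rw [hthr, hexp]
  have hdim : (((b + 1) * d : ℕ) : ℝ) ≤ n * ε ^ 2 := by
    have h := (Real.sqrt_le_left hε.le).1 h₁
    rw [div_le_iff₀ hn0] at h
    linarith
  obtain ⟨S, hSc, hS1, hSnet⟩ := exists_net (EuclideanSpace ℝ ({j // j ∈ B} × Fin d))
  obtain ⟨T, hTc, hT1, hTnet⟩ := exists_net (EuclideanSpace ℝ (Fin d))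
  have hSc' : S.card ≤ 5 ^ (b * d) := by
    simpa [finrank_euclideanSpace, hB] using hSc
  have hTc' : T.card ≤ 5 ^ d := by simpa [finrank_euclideanSpace] using hTc
  let X : EuclideanSpace ℝ ({j // j ∈ B} × Fin d) → (Fin p × Fin d → ℝ) :=
    fun x jl => if h : jl.1 ∈ B then x (⟨jl.1, h⟩, jl.2) else 0
  let Y : Fin p → EuclideanSpace ℝ (Fin d) → (Fin p × Fin d → ℝ) :=
    fun k y jl => if jl.1 = k then y jl.2 else 0
  have hXdot : ∀ (u : Fin p × Fin d → ℝ) x, u ⬝ᵥ X x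
      = ∑ jl : {j // j ∈ B} × Fin d, u (jl.1.1, jl.2) * x jl := by
    intro u x
    simp only [dotProduct, X, Fintype.sum_prod_type]
    rw [← Finset.sum_subset (Finset.subset_univ B), ← Finset.sum_coe_sort B]
    · refine Finset.sum_congr rfl fun j _ => Finset.sum_congr rfl fun l _ => ?_
      simp [j.2]
    · intro j _ hj
      simp [hj]
  have hYdot : ∀ k (u : Fin p × Fin d → ℝ) y, u ⬝ᵥ Y k y = ∑ l, u (k, l) * y l := by
    intro k u y
    simp only [dotProduct, Y, Fintype.sum_prod_type]
    rw [Finset.sum_eq_single k]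
    · simp
    · intro j _ hj; simp [hj]
    · simp
  have hXX : ∀ x ∈ S, X x ⬝ᵥ X x = 1 := by
    intro x hx
    have h := hS1 x hx
    rw [EuclideanSpace.norm_eq, Real.sqrt_eq_one] at h
    rw [hXdot, ← h]
    refine Finset.sum_congr rfl fun jl _ => ?_
    simp [X, sq]
  have hYY : ∀ k, ∀ y ∈ T, Y k y ⬝ᵥ Y k y = 1 := by
    intro k y hy
    have h := hT1 y hy
    rw [EuclideanSpace.norm_eq, Real.sqrt_eq_one] at h
    rw [hYdot, ← h]
    refine Finset.sum_congr rfl fun jl _ => ?_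
    simp [Y, sq]
  have hXY : ∀ k ∈ K, ∀ x y, X x ⬝ᵥ Y k y = 0 := by
    intro k hk x y
    rw [hYdot]
    refine Finset.sum_eq_zero fun l _ => ?_
    have : k ∉ B := fun h => (Finset.disjoint_left.1 hBK h) hk
    simp [X, this]
  have hVX : ∀ ω x, V ω *ᵥ X x = blockCols (V ω) B *ᵥ x.ofLp := by
    intro ω x; ext i
    simp only [mulVec]
    rw [hXdot]; rfl
  have hVY : ∀ ω k y, V ω *ᵥ Y k y = colBlock (V ω) k *ᵥ y.ofLp := by
    intro ω k y; ext i
    simp only [mulVec]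
    rw [hYdot]; rfl
  have hcard : (Fintype.card (Fin p × Fin d) : ℝ) = ((p * d : ℕ) : ℝ) := by simp
  have hsub : {ω | ∃ k ∈ K, 120 / 7 * ε
          ≤ specNorm (((p * d : ℕ) / (n : ℝ)) • ((blockCols (V ω) B)ᵀ * colBlock (V ω) k))}
      ⊆ ⋃ k ∈ K, ⋃ x ∈ S, ⋃ y ∈ T, {ω | 4 * ε * n ≤ (Fintype.card (Fin p × Fin d) : ℝ)
          * ((V ω *ᵥ X x) ⬝ᵥ (V ω *ᵥ Y k y))} := by
    rintro ω ⟨k, hk, hle⟩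
    by_contra hcon
    simp only [Set.mem_iUnion, Set.mem_ofPred_eq, not_exists, not_le] at hcon
    have := norm_le_of_net (LinearMap.toContinuousLinearMap (Matrix.toEuclideanLin
      (((p * d : ℕ) / (n : ℝ)) • ((blockCols (V ω) B)ᵀ * colBlock (V ω) k))))
      (T : Set _) (S : Set _) hTnet hSnet (4 * ε) (by positivity) (by
        intro y hy x hx
        have h := hcon k hk x hx y hy
        rw [hcard, hVX, hVY] at h
        have he : inner ℝ x ((LinearMap.toContinuousLinearMap (Matrix.toEuclideanLin
          (((p * d : ℕ) / (n : ℝ)) • ((blockCols (V ω) B)ᵀ * colBlock (V ω) k)))) y)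
          = ((p * d : ℕ) / (n : ℝ)) * ((blockCols (V ω) B *ᵥ x.ofLp) ⬝ᵥ
            (colBlock (V ω) k *ᵥ y.ofLp)) := by
          rw [EuclideanSpace.inner_eq_star_dotProduct]
          change ((((p * d : ℕ) / (n : ℝ)) • ((blockCols (V ω) B)ᵀ * colBlock (V ω) k)) *ᵥ y.ofLp)
            ⬝ᵥ star x.ofLp = _
          rw [star_trivial, smul_mulVec, smul_dotProduct, smul_eq_mul]
          congr 1
          rw [← mulVec_mulVec, mulVec_transpose, ← dotProduct_mulVec, dotProduct_comm]
        rw [he, div_mul_eq_mul_div, div_le_iff₀ hn0]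
        exact h.le)
    have h2 : specNorm (((p * d : ℕ) / (n : ℝ)) • ((blockCols (V ω) B)ᵀ * colBlock (V ω) k))
      ≤ 4 * (4 * ε) := this
    linarith
  have hfin : ((5 ^ (b * d) * 5 ^ d : ℕ) : ℝ) * Real.exp (-3 * n * ε ^ 2)
      ≤ 5 * Real.exp (-(n * ε ^ 2 / 2)) := by
    have h5 : (5 : ℝ) ≤ Real.exp 2 := by
      have := Real.exp_one_gt_d9
      have h2 : Real.exp 2 = Real.exp 1 * Real.exp 1 := by rw [← Real.exp_add]; norm_num
      rw [h2]; nlinarith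
    have h6 : ((5 ^ (b * d) * 5 ^ d : ℕ) : ℝ) ≤ Real.exp (2 * (n * ε ^ 2)) := by
      calc ((5 ^ (b * d) * 5 ^ d : ℕ) : ℝ) = (5 : ℝ) ^ ((b + 1) * d) := by
            rw [← pow_add, add_mul, one_mul]; push_cast; rfl
        _ ≤ (Real.exp 2) ^ ((b + 1) * d) := by gcongr
        _ = Real.exp ((((b + 1) * d : ℕ) : ℝ) * 2) := by rw [← Real.exp_nat_mul]
        _ ≤ _ := Real.exp_le_exp.2 (by linarith)
    calc _ ≤ Real.exp (2 * (n * ε ^ 2)) * Real.exp (-3 * n * ε ^ 2) := by gcongr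
      _ = Real.exp (-(n * ε ^ 2)) := by rw [← Real.exp_add]; congr 1; ring
      _ ≤ 1 * Real.exp (-(n * ε ^ 2 / 2)) := by
          rw [one_mul]
          have : 0 ≤ (n : ℝ) * ε ^ 2 := by positivity
          exact Real.exp_le_exp.2 (by linarith)
      _ ≤ _ := by gcongr; norm_num
  refine (measure_mono hsub).trans ?_
  calc P (⋃ k ∈ K, ⋃ x ∈ S, ⋃ y ∈ T, {ω | 4 * ε * n ≤ (Fintype.card (Fin p × Fin d) : ℝ)
          * ((V ω *ᵥ X x) ⬝ᵥ (V ω *ᵥ Y k y))})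
      ≤ ∑ k ∈ K, ∑ x ∈ S, ∑ y ∈ T, ENNReal.ofReal (Real.exp (-3 * n * ε ^ 2)) := by
        refine (measure_biUnion_finset_le _ _).trans (Finset.sum_le_sum fun k hk => ?_)
        refine (measure_biUnion_finset_le _ _).trans (Finset.sum_le_sum fun x hx => ?_)
        refine (measure_biUnion_finset_le _ _).trans (Finset.sum_le_sum fun y hy => ?_)
        exact pair_tail P V hV _ _ (hXX x hx) (hYY k y hy) (hXY k hk x y) ε hε.le h₄
    _ = (q : ℝ≥0∞) * ((S.card * T.card : ℕ) * ENNReal.ofReal (Real.exp (-3 * n * ε ^ 2))) := by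
        simp only [Finset.sum_const, nsmul_eq_mul, hK]
        push_cast; ring
    _ ≤ _ := by
        gcongr
        rw [← ENNReal.ofReal_natCast, ← ENNReal.ofReal_mul (by positivity)]
        apply ENNReal.ofReal_le_ofReal
        refine le_trans ?_ hfin
        gcongr
end
end
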